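/- Every chordal graph containing no induced bipartite claw, umbrella, k-net for any k ≥ 2, and k-tent for any k ≥ 3 is an interval graph, and in particular a circular-arc graph. -/

import Mathlib

open SimpleGraph

/-- The circle (of circumference 1), as the additive circle `ℝ / ℤ`. -/
abbrev Circ : Type := AddCircle (1 : ℝ)

/-- The closed arc of the circle obtained by projecting the real interval `[p.1, p.2]`. -/
def arcIcc (p : ℝ × ℝ) : Set Circ := (fun x : ℝ => (x : Circ)) '' Set.Icc p.1 p.2

/-- `M` is a circular-arc model of the graph `G`: each vertex gets a (nonempty, closed) arc,
and two distinct vertices are adjacent iff their arcs intersect. -/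
def IsCAModel {V : Type*} (G : SimpleGraph V) (M : V → ℝ × ℝ) : Prop :=
  (∀ v, (M v).1 ≤ (M v).2) ∧
  ∀ u v : V, u ≠ v → (G.Adj u v ↔ (arcIcc (M u) ∩ arcIcc (M v)).Nonempty)

/-- A circular-arc graph: the intersection graph of a finite set of arcs on a circle. -/
def IsCircularArcGraph {V : Type*} [Finite V] (G : SimpleGraph V) : Prop :=
  ∃ M : V → ℝ × ℝ, IsCAModel G M

/-- A normal Helly circular-arc graph: the intersection graph of a finite set of arcs
on a circle, no three of which together cover the circle. -/
def IsNHCAGraph {V : Type*} [Finite V] (G : SimpleGraph V) : Prop :=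
  ∃ M : V → ℝ × ℝ, IsCAModel G M ∧
    ∀ u v w : V, u ≠ v → u ≠ w → v ≠ w →
      arcIcc (M u) ∪ arcIcc (M v) ∪ arcIcc (M w) ≠ Set.univ

/-- `M` is an interval model of `G`: closed real intervals, adjacency iff intersection. -/
def IsIntervalModel {V : Type*} (G : SimpleGraph V) (M : V → ℝ × ℝ) : Prop :=
  (∀ v, (M v).1 ≤ (M v).2) ∧
  ∀ u v : V, u ≠ v →
    (G.Adj u v ↔ (Set.Icc (M u).1 (M u).2 ∩ Set.Icc (M v).1 (M v).2).Nonempty)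

/-- An interval graph: the intersection graph of a finite set of intervals on a line. -/
def IsIntervalGraph {V : Type*} [Finite V] (G : SimpleGraph V) : Prop :=
  ∃ M : V → ℝ × ℝ, IsIntervalModel G M

/-- The chordless path `P_m` on `m` vertices. -/
def pathG (m : ℕ) : SimpleGraph (Fin m) :=
  SimpleGraph.fromRel (fun i j => i.val + 1 = j.val)

/-- The chordless cycle `C_n` on `n` vertices (intended for `n ≥ 3`). -/
def cycG (n : ℕ) : SimpleGraph (Fin n) :=
  SimpleGraph.fromRel (fun i j => (i.val + 1) % n = j.val)

/-- `G` contains an induced copy of `H`. -/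
def HasInduced {W V : Type*} (H : SimpleGraph W) (G : SimpleGraph V) : Prop :=
  Nonempty (H ↪g G)

/-- Add one isolated vertex to a graph. -/
def addIsolated {V : Type*} (G : SimpleGraph V) : SimpleGraph (Option V) :=
  SimpleGraph.fromRel (fun u v => ∃ a b, u = some a ∧ v = some b ∧ G.Adj a b)

/-- Add one universal vertex to a graph. -/
def addUniversal {V : Type*} (G : SimpleGraph V) : SimpleGraph (Option V) :=
  SimpleGraph.fromRel (fun u v => (∃ a b, u = some a ∧ v = some b ∧ G.Adj a b) ∨ u = none)

/-- `C_k^*`: the chordless cycle `C_k` plus an isolated vertex. -/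
def cycStar (k : ℕ) : SimpleGraph (Option (Fin k)) := addIsolated (cycG k)

/-- The `k`-wheel: the chordless cycle `C_k` plus a universal vertex. -/
def wheelG (k : ℕ) : SimpleGraph (Option (Fin k)) := addUniversal (cycG k)

/-- The bipartite claw: `K_{1,3}` with every edge subdivided once. -/
def bipartiteClaw : SimpleGraph (Fin 7) :=
  SimpleGraph.fromEdgeSet {s(0,1), s(0,2), s(0,3), s(1,4), s(2,5), s(3,6)}

/-- The umbrella: a path `0-1-2-3-4`, a hub `5` adjacent to all path vertices,
and a vertex `6` adjacent only to the middle vertex `2` of the path. -/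
def umbrella : SimpleGraph (Fin 7) :=
  SimpleGraph.fromEdgeSet
    {s(0,1), s(1,2), s(2,3), s(3,4), s(5,0), s(5,1), s(5,2), s(5,3), s(5,4), s(6,2)}

/-- The net (= 2-net): a triangle with one pendant vertex at each corner. -/
def netG : SimpleGraph (Fin 6) :=
  SimpleGraph.fromEdgeSet {s(0,1), s(1,2), s(2,0), s(3,0), s(4,1), s(5,2)}

/-- The tent (= 3-tent = 3-sun). -/
def tentG : SimpleGraph (Fin 6) :=
  SimpleGraph.fromEdgeSet
    {s(0,1), s(1,2), s(2,0), s(3,0), s(3,1), s(4,1), s(4,2), s(5,2), s(5,0)}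

/-- The `k`-net (for `k ≥ 2`), with `k + 4` vertices: a chordless path
`p_0, …, p_k` (indices `0, …, k`), a vertex `q = k+1` adjacent to `p_0, …, p_{k-1}`,
a pendant `r = k+2` on `q`, and a pendant `t = k+3` on `p_0`. -/
def kNet (k : ℕ) : SimpleGraph (Fin (k + 4)) :=
  SimpleGraph.fromRel (fun a b =>
    (a.val + 1 = b.val ∧ b.val ≤ k) ∨
    (a.val = k + 1 ∧ b.val + 1 ≤ k) ∨
    (a.val = k + 1 ∧ b.val = k + 2) ∨
    (a.val = 0 ∧ b.val = k + 3))

/-- The `k`-tent (for `k ≥ 3`), with `k + 3` vertices: a chordless path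
`p_0, …, p_{k-3}` (indices `0, …, k-3`), a vertex `a = k-2` adjacent to `p_0`,
a vertex `q = k-1` adjacent to `a` and to `p_0, …, p_{k-4}`, a pendant `r = k` on `q`,
a vertex `z = k+1` adjacent to `a` and `q`, and a hub `h = k+2` adjacent to every
vertex except `z`.  For `k = 3` this is the `3`-sun. -/
def kTent (k : ℕ) : SimpleGraph (Fin (k + 3)) :=
  SimpleGraph.fromRel (fun x y =>
    (x.val + 1 = y.val ∧ y.val + 3 ≤ k) ∨
    (x.val + 2 = k ∧ y.val = 0) ∨
    (x.val + 2 = k ∧ y.val + 1 = k) ∨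
    (x.val + 1 = k ∧ y.val + 4 ≤ k) ∨
    (x.val = k + 1 ∧ (y.val + 2 = k ∨ y.val + 1 = k)) ∨
    (x.val + 1 = k ∧ y.val = k) ∨
    (x.val = k + 2 ∧ y.val ≤ k))

/-- The Trotter–Moore graph `G_1` (as described in the source): vertices `x=0, y=1, z=2,
w₁=3, w₂=4` with edges `xy`, `yz`, and `w₁, w₂` each adjacent to `x`, `y`, `z`. -/
def G1 : SimpleGraph (Fin 5) :=
  SimpleGraph.fromEdgeSet
    {s(0,1), s(1,2), s(3,0), s(3,1), s(3,2), s(4,0), s(4,1), s(4,2)}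

/-- The Trotter–Moore graph `G_2`: a four-cycle `0-1-2-3`, a vertex `4` adjacent to `0`,
a vertex `5` adjacent to `2`, and the edge `4-5`. -/
def G2 : SimpleGraph (Fin 6) :=
  SimpleGraph.fromEdgeSet {s(0,1), s(1,2), s(2,3), s(3,0), s(4,0), s(5,2), s(4,5)}

/-- The Trotter–Moore graph `G_3`: a five-cycle `0-1-2-3-4` plus a vertex `5`
adjacent to `0`, `2` and `3`. -/
def G3 : SimpleGraph (Fin 6) :=
  SimpleGraph.fromEdgeSet {s(0,1), s(1,2), s(2,3), s(3,4), s(4,0), s(5,0), s(5,2), s(5,3)}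

/-- The Trotter–Moore graph `G_4`: a five-cycle `0-1-2-3-4`, a vertex `5` adjacent to `0`,
a vertex `6` adjacent to `2`, and the edge `5-6`. -/
def G4 : SimpleGraph (Fin 7) :=
  SimpleGraph.fromEdgeSet
    {s(0,1), s(1,2), s(2,3), s(3,4), s(4,0), s(5,0), s(6,2), s(5,6)}

/-- The domino: two four-cycles sharing an edge (`C_6` plus one long chord). -/
def dominoG : SimpleGraph (Fin 6) :=
  SimpleGraph.fromEdgeSet {s(0,1), s(1,2), s(2,3), s(3,4), s(4,5), s(5,0), s(0,3)}

/-- The complement of the chordless six-cycle. -/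
def C6bar : SimpleGraph (Fin 6) := (cycG 6)ᶜ

/-- Gimbel's graph `F_1`: a chordless path `0-1-2-3-4` together with a vertex `5`
whose only neighbor is the middle vertex `2` of the path. -/
def F1 : SimpleGraph (Fin 6) :=
  SimpleGraph.fromEdgeSet {s(0,1), s(1,2), s(2,3), s(3,4), s(5,2)}

/-- The set `A_i` with respect to a chordless cycle `c : Fin n → V`:
vertices off the cycle adjacent to `v_{i-1}` and `v_i` having a neighbor `w`
adjacent to `v_i` but not to `v_{i-1}`. -/
def Aset {V : Type*} {n : ℕ} [NeZero n] (G : SimpleGraph V) (c : Fin n → V) (i : Fin n) : Set V :=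
  {v | v ∉ Set.range c ∧ G.Adj v (c (i - 1)) ∧ G.Adj v (c i) ∧
    ∃ w, G.Adj v w ∧ G.Adj w (c i) ∧ ¬ G.Adj w (c (i - 1))}

/-- The set `B_i`: vertices off the cycle adjacent to `v_i` and `v_{i+1}` having a
neighbor `w` adjacent to `v_i` but not to `v_{i+1}`. -/
def Bset {V : Type*} {n : ℕ} [NeZero n] (G : SimpleGraph V) (c : Fin n → V) (i : Fin n) : Set V :=
  {v | v ∉ Set.range c ∧ G.Adj v (c i) ∧ G.Adj v (c (i + 1)) ∧
    ∃ w, G.Adj v w ∧ G.Adj w (c i) ∧ ¬ G.Adj w (c (i + 1))}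

/-- The set `O_i`: vertices off the cycle whose unique neighbor on the cycle is `v_i`. -/
def Oset {V : Type*} {n : ℕ} (G : SimpleGraph V) (c : Fin n → V) (i : Fin n) : Set V :=
  {v | v ∉ Set.range c ∧ ∀ j, G.Adj v (c j) ↔ j = i}

/-- The set `T_i`: vertices off the cycle whose neighbors on the cycle are exactly
`v_i` and `v_{i+1}`, and which belong to neither `B_i` nor `A_{i+1}`. -/
def Tset {V : Type*} {n : ℕ} [NeZero n] (G : SimpleGraph V) (c : Fin n → V) (i : Fin n) : Set V :=
  {v | v ∉ Set.range c ∧ (∀ j, G.Adj v (c j) ↔ (j = i ∨ j = i + 1)) ∧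
    v ∉ Bset G c i ∪ Aset G c (i + 1)}

/-- A map between the vertex types that preserves and reflects adjacency and is injective gives an
induced copy; it suffices to compare indices `i < j`. -/
theorem hasInduced_of_lt {n : ℕ} {V : Type*} {G : SimpleGraph V} {H : SimpleGraph (Fin n)}
    (f : Fin n → V)
    (h : ∀ i j, i < j → f i ≠ f j ∧ (G.Adj (f i) (f j) ↔ H.Adj i j)) : HasInduced H G := by
  refine ⟨⟨⟨f, fun i j hij => ?_⟩, fun {i j} => ?_⟩⟩
  · rcases lt_trichotomy i j with hlt | heq | hlt
    · exact absurd hij (h i j hlt).1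
    · exact heq
    · exact absurd hij.symm (h j i hlt).1
  · rcases lt_trichotomy i j with hlt | rfl | hlt
    · exact (h i j hlt).2
    · simp
    · rw [G.adj_comm, H.adj_comm]; exact (h j i hlt).2

/-- `p 0, …, p n` is an induced path of `G`. -/
def IsInducedPath {V : Type*} (G : SimpleGraph V) (n : ℕ) (p : ℕ → V) : Prop :=
  ∀ i j, i < j → j ≤ n → p i ≠ p j ∧ (G.Adj (p i) (p j) ↔ j = i + 1)

/-- Five vertices forming an induced path. -/
structure IsInducedPathFive {V : Type*} (G : SimpleGraph V) (a b c d e : V) : Prop where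
  ab : G.Adj a b
  bc : G.Adj b c
  cd : G.Adj c d
  de : G.Adj d e
  ac : ¬ G.Adj a c
  ad : ¬ G.Adj a d
  ae : ¬ G.Adj a e
  bd : ¬ G.Adj b d
  be : ¬ G.Adj b e
  ce : ¬ G.Adj c e

theorem hasInduced_bipartiteClaw {V : Type*} {G : SimpleGraph V} {a b c d e u v : V}
    (hp : IsInducedPathFive G a b c d e) (huc : G.Adj u c) (hua : ¬ G.Adj u a)
    (hub : ¬ G.Adj u b) (hud : ¬ G.Adj u d) (hue : ¬ G.Adj u e) (huv : G.Adj u v)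
    (hva : ¬ G.Adj v a) (hvb : ¬ G.Adj v b) (hvc : ¬ G.Adj v c) (hvd : ¬ G.Adj v d)
    (hve : ¬ G.Adj v e) : HasInduced bipartiteClaw G := by
  obtain ⟨ab, bc, cd, de, ac, ad, ae, bd, be, ce⟩ := hp
  refine hasInduced_of_lt ![c, u, b, d, v, a, e] ?_
  intro i j hij
  simp only [bipartiteClaw, SimpleGraph.fromEdgeSet_adj, Set.mem_insert_iff,
    Set.mem_singleton_iff, Sym2.eq_iff]
  fin_cases i <;> fin_cases j <;> first | exact absurd hij (by decide) | skip
  all_goals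
    refine ⟨?_, ?_⟩
    · intro h
      simp at h
      grind [SimpleGraph.adj_comm, SimpleGraph.irrefl]
    · simp
      grind [SimpleGraph.adj_comm, SimpleGraph.irrefl]

theorem hasInduced_umbrella {V : Type*} {G : SimpleGraph V} {a b c d e h t : V}
    (hp : IsInducedPathFive G a b c d e) (hha : G.Adj h a) (hhb : G.Adj h b) (hhc : G.Adj h c)
    (hhd : G.Adj h d) (hhe : G.Adj h e) (htc : G.Adj t c) (hta : ¬ G.Adj t a)
    (htb : ¬ G.Adj t b) (htd : ¬ G.Adj t d) (hte : ¬ G.Adj t e) (hth : ¬ G.Adj t h) :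
    HasInduced umbrella G := by
  obtain ⟨ab, bc, cd, de, ac, ad, ae, bd, be, ce⟩ := hp
  refine hasInduced_of_lt ![a, b, c, d, e, h, t] ?_
  intro i j hij
  simp only [umbrella, SimpleGraph.fromEdgeSet_adj, Set.mem_insert_iff,
    Set.mem_singleton_iff, Sym2.eq_iff]
  fin_cases i <;> fin_cases j <;> first | exact absurd hij (by decide) | skip
  all_goals
    refine ⟨?_, ?_⟩
    · intro h
      simp at h
      grind [SimpleGraph.adj_comm, SimpleGraph.irrefl]
    · simp
      grind [SimpleGraph.adj_comm, SimpleGraph.irrefl]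

theorem hasInduced_kNet {V : Type*} {G : SimpleGraph V} {k : ℕ} (hk : 2 ≤ k) {p : ℕ → V}
    (hp : IsInducedPath G k p) {q r t : V}
    (hq : ∀ i ≤ k, G.Adj q (p i) ↔ i < k) (hqr : G.Adj q r) (hr : ∀ i ≤ k, ¬ G.Adj r (p i))
    (ht : ∀ i ≤ k, G.Adj t (p i) ↔ i = 0) (htq : ¬ G.Adj t q) (htr : ¬ G.Adj t r) :
    HasInduced (kNet k) G := by
  have hpq : ∀ i ≤ k, p i ≠ q := by
    rintro i hi rfl
    rcases hi.lt_or_eq with h | rfl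
    · exact G.loopless.irrefl _ ((hq i hi).2 h)
    · have := ((hp 0 i (by omega) le_rfl).2.1 ((hq 0 (by omega)).2 (by omega)).symm)
      omega
  have hpr : ∀ i ≤ k, p i ≠ r := by
    rintro i hi rfl
    exact absurd ((hq i hi).1 hqr) (by
      intro h
      exact hr (i + 1) h ((hp i (i + 1) (by omega) h).2.2 rfl))
  have hpt : ∀ i ≤ k, p i ≠ t := by
    rintro i hi rfl
    exact htq (by
      rcases hi.lt_or_eq with h | rfl
      · exact ((hq i hi).2 h).symm
      · have := ((hp 0 i (by omega) le_rfl).2.1 ((ht 0 (by omega)).2 rfl).symm)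
        omega)
  have hqt : q ≠ t := by
    rintro rfl
    have := (ht 1 (by omega)).1 ((hq 1 (by omega)).2 (by omega))
    omega
  have hrt : r ≠ t := by rintro rfl; exact htq hqr.symm
  let f : ℕ → V := fun i => if i ≤ k then p i else if i = k + 1 then q else
    if i = k + 2 then r else t
  have f1 : ∀ i, i ≤ k → f i = p i := fun i hi => by simp [f, hi]
  have f2 : f (k + 1) = q := by simp [f]
  have f3 : f (k + 2) = r := by simp [f]
  have f4 : f (k + 3) = t := by simp [f]
  refine hasInduced_of_lt (fun i => f i) ?_
  rintro ⟨i, hi⟩ ⟨j, hj⟩ hij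
  simp only [Fin.mk_lt_mk] at hij
  simp only [kNet, SimpleGraph.fromRel_adj, ne_eq, Fin.mk.injEq]
  rcases (by omega : j ≤ k ∨ j = k + 1 ∨ j = k + 2 ∨ j = k + 3) with hj' | rfl | rfl | rfl
  · rw [f1 i (by omega), f1 j hj']
    have := hp i j hij hj'
    exact ⟨this.1, this.2.trans (by omega)⟩
  · rw [f1 i (by omega), f2, G.adj_comm, hq i (by omega)]
    exact ⟨hpq i (by omega), by omega⟩
  · rcases (by omega : i ≤ k ∨ i = k + 1) with hi' | rfl
    · rw [f1 i hi', f3, G.adj_comm]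
      exact ⟨hpr i hi', iff_of_false (hr i hi') (by omega)⟩
    · rw [f2, f3]
      exact ⟨hqr.ne, iff_of_true hqr (by omega)⟩
  · rcases (by omega : i ≤ k ∨ i = k + 1 ∨ i = k + 2) with hi' | rfl | rfl
    · rw [f1 i hi', f4, G.adj_comm, ht i hi']
      exact ⟨hpt i hi', by omega⟩
    · rw [f2, f4, G.adj_comm]
      exact ⟨hqt, iff_of_false htq (by omega)⟩
    · rw [f3, f4, G.adj_comm]
      exact ⟨hrt, iff_of_false htr (by omega)⟩

/-- A `k`-tent, described through the induced path `z, w 0, …, w n` (with `n = k - 2`) opposite to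
the apex `r`, whose neighbours are `q` and `h`. -/
theorem hasInduced_kTent {V : Type*} {G : SimpleGraph V} {n : ℕ} (hn : 1 ≤ n) {w : ℕ → V}
    (hw : IsInducedPath G n w) {z q h r : V}
    (hz : ∀ i ≤ n, G.Adj z (w i) ↔ i = 0) (hq : ∀ i ≤ n, G.Adj q (w i) ↔ i < n)
    (hh : ∀ i ≤ n, G.Adj h (w i)) (hr : ∀ i ≤ n, ¬ G.Adj r (w i))
    (hzq : G.Adj z q) (hzh : ¬ G.Adj z h) (hzr : ¬ G.Adj z r) (hqh : G.Adj q h)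
    (hqr : G.Adj q r) (hhr : G.Adj h r) : HasInduced (kTent (n + 2)) G := by
  have hwq : ∀ i ≤ n, w i ≠ q := by
    rintro i hi rfl; exact hr i hi hqr.symm
  have hwh : ∀ i ≤ n, w i ≠ h := by
    rintro i hi rfl; exact G.loopless.irrefl _ (hh i hi)
  have hwr : ∀ i ≤ n, w i ≠ r := by
    rintro i hi rfl
    rcases hi.lt_or_eq with h | rfl
    · exact hr (i + 1) h ((hw i (i + 1) (by omega) h).2.2 rfl)
    · have := (hq i le_rfl).1 hqr
      omega
  have hwz : ∀ i ≤ n, w i ≠ z := by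
    rintro i hi rfl; exact hzh (hh i hi).symm
  have hrz : r ≠ z := by rintro rfl; exact hzh hhr.symm
  have hhz : z ≠ h := by rintro rfl; exact hzr hhr
  let f : ℕ → V := fun i => if i + 1 ≤ n then w (i + 1) else if i = n then w 0 else
    if i = n + 1 then q else if i = n + 2 then r else if i = n + 3 then z else h
  have f1 : ∀ i, i + 1 ≤ n → f i = w (i + 1) := fun i hi => if_pos hi
  have f2 : f n = w 0 := by simp [f]
  have f3 : f (n + 1) = q := by simp [f]
  have f4 : f (n + 2) = r := by simp [f]
  have f5 : f (n + 3) = z := by simp [f]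
  have f6 : f (n + 4) = h := by simp [f]
  refine hasInduced_of_lt (fun i => f i) ?_
  rintro ⟨i, hi⟩ ⟨j, hj⟩ hij
  simp only [Fin.mk_lt_mk] at hij
  simp only [kTent, SimpleGraph.fromRel_adj, ne_eq, Fin.mk.injEq]
  rcases (by omega : j + 1 ≤ n ∨ j = n ∨ j = n + 1 ∨ j = n + 2 ∨ j = n + 3 ∨ j = n + 4) with
    hj' | rfl | rfl | rfl | rfl | rfl
  · rw [f1 i (by omega), f1 j hj']
    have := hw (i + 1) (j + 1) (by omega) hj'
    exact ⟨this.1, this.2.trans (by omega)⟩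
  · rw [f1 i (by omega), f2, G.adj_comm]
    have := hw 0 (i + 1) (by omega) (by omega)
    exact ⟨this.1.symm, this.2.trans (by omega)⟩
  · rw [f3, G.adj_comm]
    rcases (by omega : i + 1 ≤ n ∨ i = n) with hi' | rfl
    · rw [f1 i hi', hq _ hi']
      exact ⟨hwq _ hi', by omega⟩
    · rw [f2, hq 0 (by omega)]
      exact ⟨hwq _ (by omega), by omega⟩
  · rw [f4, G.adj_comm]
    rcases (by omega : i + 1 ≤ n ∨ i = n ∨ i = n + 1) with hi' | rfl | rfl
    · rw [f1 i hi']
      exact ⟨hwr _ hi', iff_of_false (hr _ hi') (by omega)⟩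
    · rw [f2]
      exact ⟨hwr _ (by omega), iff_of_false (hr _ (by omega)) (by omega)⟩
    · rw [f3]
      exact ⟨hqr.ne, iff_of_true hqr.symm (by omega)⟩
  · rw [f5, G.adj_comm]
    rcases (by omega : i + 1 ≤ n ∨ i = n ∨ i = n + 1 ∨ i = n + 2) with hi' | rfl | rfl | rfl
    · rw [f1 i hi', hz _ hi']
      exact ⟨hwz _ hi', by omega⟩
    · rw [f2, hz _ (by omega)]
      exact ⟨hwz _ (by omega), by omega⟩
    · rw [f3]
      exact ⟨hzq.ne', iff_of_true hzq (by omega)⟩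
    · rw [f4]
      exact ⟨hrz, iff_of_false hzr (by omega)⟩
  · rw [f6, G.adj_comm]
    rcases (by omega : i + 1 ≤ n ∨ i = n ∨ i = n + 1 ∨ i = n + 2 ∨ i = n + 3) with
      hi' | rfl | rfl | rfl | rfl
    · rw [f1 i hi']
      exact ⟨hwh _ hi', iff_of_true (hh _ hi') (by omega)⟩
    · rw [f2]
      exact ⟨hwh _ (by omega), iff_of_true (hh _ (by omega)) (by omega)⟩
    · rw [f3]
      exact ⟨hqh.ne, iff_of_true hqh.symm (by omega)⟩
    · rw [f4]
      exact ⟨hhr.ne', iff_of_true hhr (by omega)⟩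
    · rw [f5]
      exact ⟨hhz, iff_of_false (fun h => hzh h.symm) (by omega)⟩

/-- Consecutive intervals `[l (p k), r (p k)]`, `k ≤ n`, meet, and any other two are disjoint and
ordered from left to right. -/
def IsIntervalChain {V : Type*} (l r : V → ℤ) (n : ℕ) (p : ℕ → V) : Prop :=
  (∀ k < n, l (p (k + 1)) ≤ r (p k)) ∧ ∀ j k, j + 2 ≤ k → k ≤ n → r (p j) < l (p k)

namespace IsIntervalChain

variable {V : Type*} {l r : V → ℤ} {n : ℕ} {p : ℕ → V}

theorem left_le_last (h : IsIntervalChain l r n p) (hlr : ∀ k ≤ n, l (p k) ≤ r (p k))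
    (hn : 2 ≤ n) {k : ℕ} (hk : k ≤ n) : l (p k) ≤ l (p n) := by
  rcases (by omega : k = n ∨ k + 1 = n ∨ k + 2 ≤ n) with rfl | rfl | hk'
  · rfl
  · obtain ⟨j, rfl⟩ : ∃ j, k = j + 1 := ⟨k - 1, by omega⟩
    exact (h.1 j (by omega)).trans (h.2 j (j + 2) le_rfl (by omega)).le
  · exact (hlr k hk).trans (h.2 k n hk' le_rfl).le

theorem first_le_right (h : IsIntervalChain l r n p) (hlr : ∀ k ≤ n, l (p k) ≤ r (p k))
    (hn : 2 ≤ n) {k : ℕ} (hk : k ≤ n) : r (p 0) ≤ r (p k) := by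
  rcases (by omega : k = 0 ∨ k = 1 ∨ 2 ≤ k) with rfl | rfl | hk'
  · rfl
  · exact (h.2 0 2 le_rfl hn).le.trans (h.1 1 (by omega))
  · exact (h.2 0 k (by omega) hk).le.trans (hlr k hk)

theorem left_le_right_succ (h : IsIntervalChain l r n p) (hlr : ∀ k ≤ n, l (p k) ≤ r (p k))
    (hn : 2 ≤ n) {k : ℕ} (hk : k < n) : l (p k) ≤ r (p (k + 1)) := by
  rcases (by omega : k + 2 ≤ n ∨ 1 ≤ k) with hk' | hk'
  · exact (hlr k hk.le).trans ((h.2 k (k + 2) le_rfl hk').le.trans (h.1 (k + 1) (by omega)))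
  · obtain ⟨j, rfl⟩ : ∃ j, k = j + 1 := ⟨k - 1, by omega⟩
    exact (h.1 j (by omega)).trans ((h.2 j (j + 2) le_rfl (by omega)).le.trans
      (hlr (j + 1 + 1) (by omega)))

theorem ne_succ (h : IsIntervalChain l r n p) (hn : 2 ≤ n) {k : ℕ} (hk : k < n) :
    p k ≠ p (k + 1) := by
  intro he
  rcases (by omega : k + 2 ≤ n ∨ 1 ≤ k) with hk' | hk'
  · have h1 := h.2 k (k + 2) le_rfl hk'
    have h2 := h.1 (k + 1) (by omega)
    rw [he] at h1
    exact absurd h2 (not_le.2 h1)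
  · obtain ⟨j, rfl⟩ : ∃ j, k = j + 1 := ⟨k - 1, by omega⟩
    have h1 := h.2 j (j + 2) le_rfl (by omega)
    have h2 := h.1 j (by omega)
    rw [he] at h2
    exact absurd h2 (not_le.2 h1)

theorem isInducedPath {G : SimpleGraph V} {A : Set V} (h : IsIntervalChain l r n p) (hn : 2 ≤ n)
    (hA : ∀ k ≤ n, p k ∈ A) (hlr : ∀ u ∈ A, l u ≤ r u)
    (hadj : ∀ u ∈ A, ∀ w ∈ A, u ≠ w → (G.Adj u w ↔ l u ≤ r w ∧ l w ≤ r u)) :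
    IsInducedPath G n p := by
  have hlr' : ∀ k ≤ n, l (p k) ≤ r (p k) := fun k hk => hlr _ (hA k hk)
  intro j k hjk hk
  rcases (by omega : k = j + 1 ∨ j + 2 ≤ k) with rfl | hjk'
  · have hne := h.ne_succ hn hk
    exact ⟨hne, iff_of_true ((hadj _ (hA j (by omega)) _ (hA _ hk) hne).2
      ⟨h.left_le_right_succ hlr' hn hk, h.1 j hk⟩) rfl⟩
  · have h1 := h.2 j k hjk' hk
    have hne : p j ≠ p k := by
      intro he
      have := hlr' j (by omega)
      rw [← he] at h1
      omega
    refine ⟨hne, iff_of_false ?_ (by omega)⟩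
    rw [hadj _ (hA j (by omega)) _ (hA _ hk) hne]
    omega

/-- The members of a chain whose right end reaches `a` form a final segment. -/
theorem exists_first (h : IsIntervalChain l r n p) (hlr : ∀ k ≤ n, l (p k) ≤ r (p k)) {a : ℤ}
    (h0 : r (p 0) < a) (ha : a ≤ l (p n)) :
    ∃ m, 1 ≤ m ∧ m ≤ n ∧ ∀ k ≤ n, a ≤ r (p k) ↔ m ≤ k := by
  classical
  have hex : ∃ k, k ≤ n ∧ a ≤ r (p k) := ⟨n, le_rfl, ha.trans (hlr n le_rfl)⟩
  obtain ⟨hm, hma⟩ := Nat.find_spec hex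
  have hmin : ∀ k, k < Nat.find hex → ¬ (k ≤ n ∧ a ≤ r (p k)) := fun k => Nat.find_min hex
  generalize Nat.find hex = m at hm hma hmin
  refine ⟨m, ?_, hm, fun k hk => ⟨fun hka => ?_, fun hmk => ?_⟩⟩
  · by_contra! hm0
    obtain rfl : m = 0 := by omega
    omega
  · by_contra! hkm
    exact hmin k hkm ⟨hk, hka⟩
  · rcases (by omega : k = m ∨ k = n ∨ k = m + 1 ∧ k < n ∨ m + 2 ≤ k) with
      rfl | rfl | ⟨rfl, hk'⟩ | hk'
    · exact hma
    · exact ha.trans (hlr _ le_rfl)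
    · exact hma.trans ((h.2 m (m + 2) le_rfl hk').le.trans (h.1 (m + 1) hk'))
    · exact hma.trans ((h.2 m k hk' hk).le.trans (hlr _ hk))

/-- The members of a chain whose left end is at most `a` form an initial segment. -/
theorem exists_last (h : IsIntervalChain l r n p) (hlr : ∀ k ≤ n, l (p k) ≤ r (p k)) {a : ℤ}
    (h0 : l (p 0) ≤ a) (ha : a < l (p n)) :
    ∃ m, m < n ∧ ∀ k ≤ n, l (p k) ≤ a ↔ k ≤ m := by
  classical
  have hex : ∃ k, k ≤ n ∧ a < l (p k) := ⟨n, le_rfl, ha⟩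
  obtain ⟨hm, hma⟩ := Nat.find_spec hex
  have hmin : ∀ k, k < Nat.find hex → ¬ (k ≤ n ∧ a < l (p k)) := fun k => Nat.find_min hex
  generalize Nat.find hex = m at hm hma hmin
  obtain ⟨m, rfl⟩ : ∃ m', m = m' + 1 := by
    refine ⟨m - 1, ?_⟩
    by_contra hm0
    obtain rfl : m = 0 := by omega
    omega
  refine ⟨m, hm, fun k hk => ⟨fun hka => ?_, fun hkm => ?_⟩⟩
  · by_contra! hmk
    rcases (by omega : k = m + 1 ∨ k = m + 2 ∨ m + 3 ≤ k) with rfl | rfl | hk'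
    · omega
    · have h1 := h.2 m (m + 2) le_rfl hk
      have h2 := h.1 m (by omega)
      omega
    · have h1 := h.2 (m + 1) k (by omega) hk
      have h2 := hlr (m + 1) hm
      omega
  · by_contra! hka
    exact hmin k (by omega) ⟨hk, hka⟩

end IsIntervalChain

/-- If every unit step strictly between `s` and `e` is crossed by a member of `F`, a greedy choice
gives a chain from `s` to `e` with inner members in `F`. -/
theorem exists_isIntervalChain {V : Type*} [Finite V] {l r : V → ℤ} {F : Set V} {s e : V}
    (hse : r s < l e)
    (hF : ∀ z, r s ≤ z → z < l e → ∃ f ∈ F, l f ≤ z ∧ z + 1 ≤ r f) :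
    ∃ n p, 2 ≤ n ∧ IsIntervalChain l r n p ∧ p 0 = s ∧ p n = e ∧ ∀ k, 0 < k → k < n → p k ∈ F := by
  induction hN : (l e - r s).toNat using Nat.strong_induction_on generalizing s with
  | _ N ih =>
  obtain ⟨f, ⟨hfF, hfl⟩, hmax⟩ := Set.exists_max_image {f ∈ F | l f ≤ r s} r (Set.toFinite _)
    (by obtain ⟨f, hf, h1, -⟩ := hF (r s) le_rfl hse; exact ⟨f, hf, h1⟩)
  have hf1 : r s + 1 ≤ r f := by
    obtain ⟨g, hg, h1, h2⟩ := hF (r s) le_rfl hse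
    exact h2.trans (hmax g ⟨hg, h1⟩)
  by_cases hfe : l e ≤ r f
  · refine ⟨2, fun k => if k = 0 then s else if k = 1 then f else e, le_rfl, ⟨?_, ?_⟩, by simp,
      by simp, ?_⟩
    · intro k hk
      obtain rfl | rfl : k = 0 ∨ k = 1 := by omega
      · simpa using hfl
      · simpa using hfe
    · intro j k hjk hk
      obtain ⟨rfl, rfl⟩ : j = 0 ∧ k = 2 := by omega
      simpa using hse
    · intro k h0 h2
      obtain rfl : k = 1 := by omega
      simpa using hfF
  · obtain ⟨n, p, hn, hp, hp0, hpn, hpF⟩ := ih (l e - r f).toNat (by omega) (s := f) (by omega)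
      (fun z hz hze => hF z (by omega) hze) rfl
    refine ⟨n + 1, fun k => if k = 0 then s else p (k - 1), by omega, ⟨?_, ?_⟩, by simp,
      by simpa using hpn, ?_⟩
    · rintro (_ | k) hk
      · simpa [hp0] using hfl
      · simpa using hp.1 k (by omega)
    · rintro (_ | j) (_ | k) hjk hk
      · omega
      · simp only [if_true, Nat.add_sub_cancel, Nat.add_eq_zero_iff, one_ne_zero, and_false,
          if_false]
        rcases (by omega : k = n ∨ k = 1 ∧ k < n ∨ 2 ≤ k) with rfl | ⟨rfl, hk'⟩ | hk'
        · rw [hpn]; omega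
        · by_contra! hlt
          have h1 := hmax (p 1) ⟨hpF 1 one_pos hk', hlt⟩
          have h2 := hp.2 0 2 le_rfl hn
          have h3 : l (p 2) ≤ r (p 1) := hp.1 1 hk'
          rw [hp0] at h2
          omega
        · have := hp.2 0 k (by omega) (by omega)
          rw [hp0] at this
          omega
      · omega
      · simpa using hp.2 j k (by omega) (by omega)
    · rintro (_ | k) h0 hk
      · omega
      · rcases Nat.eq_zero_or_pos k with rfl | hk0
        · simpa [hp0] using hfF
        · simpa using hpF k hk0 (by omega)

theorem IsInducedPath.shift {V : Type*} {G : SimpleGraph V} {n : ℕ} {p : ℕ → V}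
    (h : IsInducedPath G n p) {a m : ℕ} (ha : a + m ≤ n) :
    IsInducedPath G m (fun k => p (a + k)) := by
  intro j k hjk hk
  have := h (a + j) (a + k) (by omega) (by omega)
  exact ⟨this.1, this.2.trans (by omega)⟩

/-- `G` contains one of the chordal Lekkerkerker–Boland obstructions. -/
def HasObstruction {V : Type*} (G : SimpleGraph V) : Prop :=
  HasInduced bipartiteClaw G ∨ HasInduced umbrella G ∨ (∃ k, 2 ≤ k ∧ HasInduced (kNet k) G) ∨
    ∃ k, 3 ≤ k ∧ HasInduced (kTent k) G

/-- An interval model on `A`, together with a vertex `v` whose neighbourhood in `A` is the clique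
`C`, and a window `[L, R]` witnessing that `v` cannot be inserted into any rearrangement of the
model. -/
structure ObstructedWindow {V : Type*} (G : SimpleGraph V) where
  A : Set V
  C : Set V
  v : V
  b : V
  c : V
  x : V
  y : V
  l : V → ℤ
  r : V → ℤ
  L : ℤ
  i : ℤ
  R : ℤ
  left_le_right : ∀ u ∈ A, l u ≤ r u
  adj_iff : ∀ u ∈ A, ∀ w ∈ A, u ≠ w → (G.Adj u w ↔ l u ≤ r w ∧ l w ≤ r u)
  adj_v : ∀ u ∈ A, (G.Adj v u ↔ u ∈ C)
  C_subset : C ⊆ A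
  left_C : ∀ u ∈ C, l u ≤ i
  right_C : ∀ u ∈ C, i ≤ r u
  L_lt : L < i
  lt_R : i < R
  hb : b ∈ A \ C
  hc : c ∈ A \ C
  right_b : r b = L
  left_c : l c = R
  hx : x ∈ C
  right_x : r x < R
  min_x : ∀ u ∈ C, r u < R → l x ≤ l u
  hy : y ∈ C
  left_y : L < l y
  max_y : ∀ u ∈ C, L < l u → r u ≤ r y
  cover : ∀ z, L ≤ z → z < R → ∃ f ∈ A \ C, l f ≤ z ∧ z + 1 ≤ r f
  cover_left : ∀ z, L ≤ z → z < i → ∃ f ∈ A, r f < R ∧ l f ≤ z ∧ z + 1 ≤ r f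
  cover_right : ∀ z, i ≤ z → z < R → ∃ f ∈ A, L < l f ∧ l f ≤ z ∧ z + 1 ≤ r f

namespace ObstructedWindow

variable {V : Type*} {G : SimpleGraph V} (W : ObstructedWindow G)

/-- The left-right reflection of a window. -/
def mirror : ObstructedWindow G where
  A := W.A
  C := W.C
  v := W.v
  b := W.c
  c := W.b
  x := W.y
  y := W.x
  l u := -W.r u
  r u := -W.l u
  L := -W.R
  i := -W.i
  R := -W.L
  left_le_right u hu := neg_le_neg (W.left_le_right u hu)
  adj_iff u hu w hw huw := by
    rw [W.adj_iff u hu w hw huw, neg_le_neg_iff, neg_le_neg_iff, and_comm]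
  adj_v := W.adj_v
  C_subset := W.C_subset
  left_C u hu := neg_le_neg (W.right_C u hu)
  right_C u hu := neg_le_neg (W.left_C u hu)
  L_lt := neg_lt_neg W.lt_R
  lt_R := neg_lt_neg W.L_lt
  hb := W.hc
  hc := W.hb
  right_b := congrArg _ W.left_c
  left_c := congrArg _ W.right_b
  hx := W.hy
  right_x := neg_lt_neg W.left_y
  min_x u hu h := neg_le_neg (W.max_y u hu (by simpa using h))
  hy := W.hx
  left_y := neg_lt_neg W.right_x
  max_y u hu h := neg_le_neg (W.min_x u hu (by simpa using h))
  cover z h1 h2 := by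
    obtain ⟨f, hf, h3, h4⟩ := W.cover (-z - 1) (by omega) (by omega)
    exact ⟨f, hf, by omega, by omega⟩
  cover_left z h1 h2 := by
    obtain ⟨f, hf, h3, h4, h5⟩ := W.cover_right (-z - 1) (by omega) (by omega)
    exact ⟨f, hf, by omega, by omega, by omega⟩
  cover_right z h1 h2 := by
    obtain ⟨f, hf, h3, h4, h5⟩ := W.cover_left (-z - 1) (by omega) (by omega)
    exact ⟨f, hf, by omega, by omega, by omega⟩

variable {W}

theorem adj_C_iff {u w : V} (hu : u ∈ W.C) (hw : w ∈ W.A \ W.C) :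
    G.Adj u w ↔ W.l u ≤ W.r w ∧ W.l w ≤ W.r u :=
  W.adj_iff u (W.C_subset hu) w hw.1 (by rintro rfl; exact hw.2 hu)

theorem not_adj_v {u : V} (hu : u ∈ W.A \ W.C) : ¬ G.Adj W.v u :=
  fun h => hu.2 ((W.adj_v u hu.1).1 h)

theorem adj_v_of_mem {u : V} (hu : u ∈ W.C) : G.Adj W.v u :=
  (W.adj_v u (W.C_subset hu)).2 hu

theorem adj_of_mem_C {u w : V} (hu : u ∈ W.C) (hw : w ∈ W.C) (h : u ≠ w) : G.Adj u w :=
  (W.adj_iff u (W.C_subset hu) w (W.C_subset hw) h).2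
    ⟨(W.left_C u hu).trans (W.right_C w hw), (W.left_C w hw).trans (W.right_C u hu)⟩

theorem left_x_le : W.l W.x ≤ W.i := W.left_C _ W.hx
theorem le_right_x : W.i ≤ W.r W.x := W.right_C _ W.hx
theorem left_y_le : W.l W.y ≤ W.i := W.left_C _ W.hy
theorem le_right_y : W.i ≤ W.r W.y := W.right_C _ W.hy

variable (W)

/-- A chain from `b` to `c` avoiding `C`. -/
structure IsSpine (n : ℕ) (p : ℕ → V) : Prop where
  two_le : 2 ≤ n
  chain : IsIntervalChain W.l W.r n p
  zero : p 0 = W.b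
  last : p n = W.c
  mem : ∀ k ≤ n, p k ∈ W.A \ W.C

variable {W} {n : ℕ} {p : ℕ → V}

theorem IsSpine.lr (h : W.IsSpine n p) : ∀ k ≤ n, W.l (p k) ≤ W.r (p k) :=
  fun k hk => W.left_le_right _ (h.mem k hk).1

theorem IsSpine.isInducedPath (h : W.IsSpine n p) : IsInducedPath G n p :=
  h.chain.isInducedPath h.two_le (fun k hk => (h.mem k hk).1) W.left_le_right W.adj_iff

theorem IsSpine.left_le (h : W.IsSpine n p) {k : ℕ} (hk : k ≤ n) : W.l (p k) ≤ W.R := by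
  have := h.chain.left_le_last h.lr h.two_le hk
  rwa [h.last, W.left_c] at this

theorem IsSpine.le_right (h : W.IsSpine n p) {k : ℕ} (hk : k ≤ n) : W.L ≤ W.r (p k) := by
  have := h.chain.first_le_right h.lr h.two_le hk
  rwa [h.zero, W.right_b] at this

theorem exists_isSpine [Finite V] {F : Set V} (hF : F ⊆ W.A \ W.C)
    (hcov : ∀ z, W.L ≤ z → z < W.R → ∃ f ∈ F, W.l f ≤ z ∧ z + 1 ≤ W.r f) :
    ∃ n p, W.IsSpine n p ∧ ∀ k, 0 < k → k < n → p k ∈ F := by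
  have h1 := W.right_b
  have h2 := W.left_c
  have h3 := W.L_lt
  have h4 := W.lt_R
  obtain ⟨n, p, hn, hp, hp0, hpn, hpF⟩ := exists_isIntervalChain (l := W.l) (r := W.r) (F := F)
    (s := W.b) (e := W.c) (by omega) (by rwa [h1, h2])
  refine ⟨n, p, ⟨hn, hp, hp0, hpn, fun k hk => ?_⟩, hpF⟩
  rcases (by omega : k = 0 ∨ k = n ∨ 0 < k ∧ k < n) with rfl | rfl | ⟨h, hkn⟩
  · rw [hp0]; exact W.hb
  · rw [hpn]; exact W.hc
  · exact hF (hpF k h hkn)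

/-- The neighbours on a spine of a member of `C` strictly inside the window. -/
theorem IsSpine.exists_range (h : W.IsSpine n p) {u : V} (hu : u ∈ W.C) (hl : W.L < W.l u)
    (hr : W.r u < W.R) : ∃ j k, 1 ≤ j ∧ j ≤ k ∧ k < n ∧
      (∀ m ≤ n, W.l u ≤ W.r (p m) ↔ j ≤ m) ∧ ∀ m ≤ n, W.l (p m) ≤ W.r u ↔ m ≤ k := by
  have hlr := W.left_le_right u (W.C_subset hu)
  obtain ⟨j, hj1, hjn, hj⟩ := h.chain.exists_first h.lr (a := W.l u)
    (by rw [h.zero, W.right_b]; exact hl) (by rw [h.last, W.left_c]; omega)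
  obtain ⟨k, hkn, hk⟩ := h.chain.exists_last h.lr (a := W.r u)
    (by have := h.lr 0 (by omega); rw [h.zero] at this ⊢; rw [W.right_b] at this; omega)
    (by rw [h.last, W.left_c]; exact hr)
  refine ⟨j, k, hj1, ?_, hkn, hj, hk⟩
  by_contra! hkj
  have h1 := h.chain.1 k hkn
  have h2 := (hj k hkn.le).not.2 (by omega)
  have h3 := (hk (k + 1) hkn).not.2 (by omega)
  omega

/-- A member of `C` strictly inside the window with two neighbours on a spine gives a net. -/
theorem IsSpine.hasObstruction (h : W.IsSpine n p) {u : V} (hu : u ∈ W.C) {j k : ℕ} (hj1 : 1 ≤ j)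
    (hjk : j < k) (hkn : k < n) (hj : ∀ m ≤ n, W.l u ≤ W.r (p m) ↔ j ≤ m)
    (hk : ∀ m ≤ n, W.l (p m) ≤ W.r u ↔ m ≤ k) : HasObstruction G := by
  obtain ⟨j, rfl⟩ : ∃ j', j = j' + 1 := ⟨j - 1, by omega⟩
  have hadj : ∀ m ≤ n, G.Adj u (p m) ↔ j + 1 ≤ m ∧ m ≤ k := fun m hm => by
    rw [adj_C_iff hu (h.mem m hm), hj m hm, hk m hm]
  refine Or.inr (Or.inr (Or.inl ⟨k - j, by omega, hasInduced_kNet (by omega)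
    (h.isInducedPath.shift (a := j + 1) (by omega)) (q := u) (r := W.v) (t := p j)
    (fun m hm => ?_) (adj_v_of_mem hu).symm (fun m hm => not_adj_v (h.mem _ (by omega)))
    (fun m hm => ?_) (fun hh => ?_) fun hh => not_adj_v (h.mem j (by omega)) hh.symm⟩))
  · rw [hadj _ (by omega)]; omega
  · rw [(h.isInducedPath j (j + 1 + m) (by omega) (by omega)).2]; omega
  · have := (hadj j (by omega)).1 hh.symm
    omega

/-- A chain from `x` leftwards to `b` staying left of `R` and, apart from `x`, avoiding `C`. -/
structure IsLeftLeg (W : ObstructedWindow G) (n : ℕ) (p : ℕ → V) : Prop where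
  two_le : 2 ≤ n
  chain : IsIntervalChain (fun u => -W.r u) (fun u => -W.l u) n p
  zero : p 0 = W.x
  last : p n = W.b
  mem : ∀ k, 0 < k → k ≤ n → p k ∈ W.A \ W.C
  right_lt : ∀ k ≤ n, W.r (p k) < W.R

theorem exists_isLeftLeg [Finite V] (hx : W.L < W.l W.x) : ∃ n p, W.IsLeftLeg n p := by
  have h1 := W.right_b
  have h2 := W.L_lt
  have h3 := W.lt_R
  have h4 := W.left_x_le
  obtain ⟨n, p, hn, hp, hp0, hpn, hpF⟩ := exists_isIntervalChain (l := fun u => -W.r u)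
    (r := fun u => -W.l u) (F := {f ∈ W.A \ W.C | W.r f < W.R}) (s := W.x) (e := W.b) (by omega)
    (fun z hz1 hz2 => by
      obtain ⟨f, hfA, hfR, hf1, hf2⟩ := W.cover_left (-z - 1) (by omega) (by omega)
      refine ⟨f, ⟨⟨hfA, fun hfC => ?_⟩, hfR⟩, by omega, by omega⟩
      have := W.min_x f hfC hfR
      omega)
  refine ⟨n, p, hn, hp, hp0, hpn, fun k hk0 hk => ?_, fun k hk => ?_⟩
  · rcases hk.lt_or_eq with hk | rfl
    · exact (hpF k hk0 hk).1
    · rw [hpn]; exact W.hb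
  · rcases (by omega : k = 0 ∨ k = n ∨ 0 < k ∧ k < n) with rfl | rfl | ⟨h, h'⟩
    · rw [hp0]; exact W.right_x
    · rw [hpn]; omega
    · exact (hpF k h h').2

theorem IsLeftLeg.memA (h : W.IsLeftLeg n p) : ∀ k ≤ n, p k ∈ W.A := by
  rintro (_ | k) hk
  · rw [h.zero]; exact W.C_subset W.hx
  · exact (h.mem _ (by omega) hk).1

theorem IsLeftLeg.lr (h : W.IsLeftLeg n p) : ∀ k ≤ n, W.l (p k) ≤ W.r (p k) :=
  fun k hk => W.left_le_right _ (h.memA k hk)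

theorem IsLeftLeg.isInducedPath (h : W.IsLeftLeg n p) : IsInducedPath G n p :=
  h.chain.isInducedPath h.two_le h.memA W.mirror.left_le_right W.mirror.adj_iff

theorem IsLeftLeg.le_right (h : W.IsLeftLeg n p) {k : ℕ} (hk : k ≤ n) : W.L ≤ W.r (p k) := by
  have := h.chain.left_le_last (fun k hk => neg_le_neg (h.lr k hk)) h.two_le hk
  simp only [h.last, W.right_b] at this
  omega

/-- The first member of the leg lying entirely to the left of `a`. -/
theorem IsLeftLeg.exists_first (h : W.IsLeftLeg n p) {a : ℤ} (h0 : W.L < a)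
    (ha : a ≤ W.r W.x) :
    ∃ m < n, ∀ k ≤ n, a ≤ W.r (p k) ↔ k ≤ m := by
  obtain ⟨m, hm, hmk⟩ := h.chain.exists_last (fun k hk => neg_le_neg (h.lr k hk)) (a := -a)
    (by simpa [h.zero] using ha) (by simpa [h.last, W.right_b] using h0)
  exact ⟨m, hm, fun k hk => by rw [← hmk k hk, neg_le_neg_iff]⟩


/-- A vertex `d` with `x ⊆ d` reaching from inside the window to its right border gives a net. -/
theorem hasObstruction_of_hub [Finite V] (hx : W.L < W.l W.x) {d : V} (hd : d ∈ W.A \ W.C)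
    (hL : W.L < W.l d) (hdx : W.l d ≤ W.l W.x) (hR : W.R ≤ W.r d) :
    HasObstruction G := by
  obtain ⟨n, p, h⟩ := exists_isLeftLeg hx
  have hxx := W.left_le_right _ (W.C_subset W.hx)
  have hlx := W.left_x_le
  have hiR := W.lt_R
  have hc := W.left_c
  have hcr := W.left_le_right _ W.hc.1
  obtain ⟨m, hmn, hm⟩ := h.exists_first hL (by omega)
  have hm1 : 1 ≤ m := by
    rw [← hm 1 (by have := h.two_le; omega)]
    have h1 := h.chain.1 0 (by have := h.two_le; omega)
    rw [h.zero] at h1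
    simp only [zero_add, neg_le_neg_iff] at h1
    omega
  have hdp : ∀ k ≤ n, G.Adj d (p k) ↔ k ≤ m := by
    intro k hk
    rw [← hm k hk]
    rcases Nat.eq_zero_or_pos k with rfl | hk0
    · rw [h.zero, G.adj_comm, adj_C_iff W.hx hd]
      omega
    · have h1 := h.right_lt k hk
      have h2 := h.lr k hk
      rw [W.adj_iff d hd.1 _ (h.mem k hk0 hk).1 (by rintro rfl; omega)]
      omega
  have hpc : ∀ k ≤ n, ¬ G.Adj W.c (p k) := by
    intro k hk hadj
    have h1 := h.right_lt k hk
    have h2 := ((W.adj_iff _ W.hc.1 _ (h.memA k hk) (by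
      intro he
      rw [← he] at h1
      omega)).1 hadj).1
    omega
  refine Or.inr (Or.inr (Or.inl ⟨m + 1, by omega, hasInduced_kNet (by omega)
    (by simpa using h.isInducedPath.shift (a := 0) (m := m + 1) (by omega)) (q := d) (r := W.c)
    (t := W.v) (fun k hk => ?_) ?_ (fun k hk => hpc k (by omega)) (fun k hk => ?_)
    (not_adj_v hd) (not_adj_v W.hc)⟩))
  · rw [hdp k (by omega)]; omega
  · rw [W.adj_iff d hd.1 _ W.hc.1 (by rintro rfl; omega)]
    omega
  · rcases Nat.eq_zero_or_pos k with rfl | hk0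
    · rw [h.zero]
      exact iff_of_true (adj_v_of_mem W.hx) rfl
    · exact iff_of_false (not_adj_v (h.mem k hk0 (by omega))) (by omega)

/-- Both `x` and `y` leave the window: a tent. -/
theorem hasObstruction_of_left_le_of_le_right [Finite V] (hx : W.l W.x ≤ W.L)
    (hy : W.R ≤ W.r W.y) : HasObstruction G := by
  obtain ⟨n, p, h, -⟩ := exists_isSpine (W := W) subset_rfl W.cover
  have h1 := W.left_x_le
  have h2 := W.le_right_x
  have h3 := W.left_y_le
  have h4 := W.le_right_y
  have h5 := W.left_y
  have h6 := W.right_x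
  have h7 := W.L_lt
  have h8 := W.lt_R
  obtain ⟨j, hj1, hjn, hj⟩ := h.chain.exists_first h.lr (a := W.l W.y)
    (by rwa [h.zero, W.right_b]) (by rw [h.last, W.left_c]; omega)
  obtain ⟨k, hkn, hk⟩ := h.chain.exists_last h.lr (a := W.r W.x)
    (by have := h.lr 0 (by omega); rw [h.zero] at this ⊢; rw [W.right_b] at this; omega)
    (by rwa [h.last, W.left_c])
  have hjk : j ≤ k := by
    by_contra! hkj
    have h1 := h.chain.1 k hkn
    have h2 := (hj k hkn.le).not.2 (by omega)
    have h3 := (hk (k + 1) hkn).not.2 (by omega)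
    omega
  obtain ⟨j, rfl⟩ : ∃ j', j = j' + 1 := ⟨j - 1, by omega⟩
  have hxp : ∀ m ≤ n, G.Adj W.x (p m) ↔ m ≤ k := fun m hm => by
    rw [adj_C_iff W.hx (h.mem m hm), ← hk m hm]
    have := h.le_right hm
    omega
  have hyp : ∀ m ≤ n, G.Adj W.y (p m) ↔ j + 1 ≤ m := fun m hm => by
    rw [adj_C_iff W.hy (h.mem m hm), ← hj m hm]
    have := h.left_le hm
    omega
  have hxy : W.x ≠ W.y := by
    intro he
    rw [← he] at hy
    omega
  refine Or.inr (Or.inr (Or.inr ⟨k - j + 2, by omega, hasInduced_kTent (by omega)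
    (h.isInducedPath.shift (a := j + 1) (by omega)) (z := p j) (q := W.x) (h := W.y) (r := W.v)
    (fun m hm => ?_) (fun m hm => ?_) (fun m hm => ?_) (fun m hm => not_adj_v (h.mem _ (by omega)))
    ?_ ?_ (fun hh => not_adj_v (h.mem j (by omega)) hh.symm) (adj_of_mem_C W.hx W.hy hxy)
    (adj_v_of_mem W.hx).symm (adj_v_of_mem W.hy).symm⟩))
  · rw [(h.isInducedPath j (j + 1 + m) (by omega) (by omega)).2]; omega
  · rw [hxp _ (by omega)]; omega
  · rw [hyp _ (by omega)]; omega
  · rw [G.adj_comm, hxp _ (by omega)]; omega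
  · rw [G.adj_comm, hyp _ (by omega)]; omega

/-- A vertex `d` spanning the window, adjacent to every vertex of the leg. -/
theorem IsLeftLeg.adj_hub (h : W.IsLeftLeg n p) {d : V} (hd : d ∈ W.A \ W.C)
    (hdL : W.l d ≤ W.L) (hdR : W.R ≤ W.r d) {k : ℕ} (hk : k ≤ n) : G.Adj d (p k) := by
  have h1 := h.right_lt k hk
  have h2 := h.lr k hk
  have h3 := h.le_right hk
  rw [W.adj_iff d hd.1 _ (h.memA k hk) (by rintro rfl; omega)]
  omega

/-- A vertex `e` to the right of the leg that meets `y` is the apex of a tent. -/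
theorem IsLeftLeg.hasObstruction_of_apex (h : W.IsLeftLeg n p) {z : ℤ} (hz : W.L ≤ z)
    (hpz : ∀ k, 0 < k → k ≤ n → W.r (p k) ≤ z) {d e : V} (hd : d ∈ W.A \ W.C)
    (hdL : W.l d ≤ W.L) (hdR : W.R ≤ W.r d) (he : e ∈ W.A \ W.C) (hze : z + 1 ≤ W.l e)
    (hxe : W.r W.x < W.l e) (hey : W.l e ≤ W.r W.y) (heR : W.l e ≤ W.R) : HasObstruction G := by
  have hly := W.left_y
  have hyi := W.left_y_le
  have hix := W.le_right_x
  have hiR := W.lt_R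
  have hLi := W.L_lt
  have hn := h.two_le
  have hlre := W.left_le_right e he.1
  obtain ⟨m, hmn, hm⟩ := h.exists_first hly (by omega)
  have hxy : W.y ≠ W.x := by
    intro hh
    rw [hh] at hey
    omega
  have hep : ∀ k ≤ n, ¬ G.Adj e (p k) := by
    intro k hk
    have hlt : W.r (p k) < W.l e := by
      rcases Nat.eq_zero_or_pos k with rfl | hk0
      · rwa [h.zero]
      · have := hpz k hk0 hk
        omega
    have := h.lr k hk
    rw [W.adj_iff e he.1 _ (h.memA k hk) (by rintro rfl; omega)]
    omega
  have hyp : ∀ k ≤ n, G.Adj W.y (p k) ↔ k ≤ m := by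
    intro k hk
    rcases Nat.eq_zero_or_pos k with rfl | hk0
    · rw [h.zero]
      exact iff_of_true (adj_of_mem_C W.hy W.hx hxy) (Nat.zero_le _)
    · rw [adj_C_iff W.hy (h.mem k hk0 hk), hm k hk]
      have := h.lr k hk
      have := hpz k hk0 hk
      omega
  refine Or.inr (Or.inr (Or.inr ⟨m + 1 + 2, by omega, hasInduced_kTent (n := m + 1) (by omega)
    (by simpa using h.isInducedPath.shift (a := 0) (m := m + 1) (by omega)) (z := W.v)
    (q := W.y) (h := d) (r := e) (fun k hk => ?_) (fun k hk => ?_)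
    (fun k hk => h.adj_hub hd hdL hdR (by omega)) (fun k hk => hep k (by omega))
    (adj_v_of_mem W.hy) (not_adj_v hd) (not_adj_v he) ?_ ?_ ?_⟩))
  · rcases Nat.eq_zero_or_pos k with rfl | hk0
    · rw [h.zero]
      exact iff_of_true (adj_v_of_mem W.hx) rfl
    · exact iff_of_false (not_adj_v (h.mem k hk0 (by omega))) (by omega)
  · rw [hyp k (by omega)]; omega
  · rw [adj_C_iff W.hy hd]; omega
  · rw [adj_C_iff W.hy he]; omega
  · rw [W.adj_iff d hd.1 e he.1 (by rintro rfl; omega)]; omega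

/-- The reflected chain: from `y` rightwards to `c`, staying right of `L`. -/
theorem exists_rightLeg [Finite V] (hy : W.r W.y < W.R) :
    ∃ n p, 2 ≤ n ∧ IsIntervalChain W.l W.r n p ∧ p 0 = W.y ∧ p n = W.c ∧
      (∀ k, 0 < k → k ≤ n → p k ∈ W.A \ W.C) ∧ ∀ k ≤ n, W.L < W.l (p k) := by
  obtain ⟨n, p, h⟩ := exists_isLeftLeg (W := W.mirror) (neg_lt_neg hy)
  refine ⟨n, p, h.two_le, ?_, h.zero, h.last, h.mem, fun k hk => neg_lt_neg_iff.1 (h.right_lt k hk)⟩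
  simpa [mirror] using h.chain

/-- A unit step which no vertex avoiding `C` crosses, except those spanning the whole window. -/
theorem hasObstruction_of_gap [Finite V] (hx : W.L < W.l W.x) {z : ℤ} (hz : W.L ≤ z) (hzR : z < W.R)
    (hgap : ∀ f ∈ W.A \ W.C, W.l f ≤ z → z + 1 ≤ W.r f → W.l f ≤ W.L ∧ W.R ≤ W.r f) :
    HasObstruction G := by
  obtain ⟨n, p, h⟩ := exists_isLeftLeg hx
  obtain ⟨d, hd, hd1, hd2⟩ := W.cover z hz hzR
  obtain ⟨hdL, hdR⟩ := hgap d hd hd1 hd2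
  have hn := h.two_le
  have hix := W.le_right_x
  have hxi := W.left_x_le
  have hrx := W.right_x
  have hiR := W.lt_R
  have hLi := W.L_lt
  have hc := W.left_c
  have hpz : ∀ k, 0 < k → k ≤ n → W.r (p k) ≤ z := by
    intro k hk0 hk
    induction hk using Nat.decreasingInduction with
    | self => rw [h.last, W.right_b]; exact hz
    | of_succ k hk ih =>
      have h1 := neg_le_neg_iff.1 (h.chain.1 k hk)
      have h2 := h.lr (k + 1) hk
      have h3 := h.right_lt k hk.le
      by_contra! hlt
      have := hgap _ (h.mem k hk0 hk.le) (by have := ih (by omega); omega) (by omega)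
      omega
  by_cases hy : W.r W.y < W.R
  swap
  · exact h.hasObstruction_of_apex hz hpz hd hdL hdR W.hc (by omega) (by omega) (by omega)
      (by omega)
  obtain ⟨m, q, hm, hq, hq0, hqm, hqA, hqL⟩ := exists_rightLeg hy
  have hqlr : ∀ k ≤ m, W.l (q k) ≤ W.r (q k) := by
    rintro (_ | k) hk
    · rw [hq0]; exact W.left_le_right _ (W.C_subset W.hy)
    · exact W.left_le_right _ (hqA _ (by omega) hk).1
  have hqR : ∀ k ≤ m, W.l (q k) ≤ W.R := by
    intro k hk
    have := hq.left_le_last hqlr hm hk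
    rwa [hqm, hc] at this
  have hqz : ∀ k, 0 < k → k ≤ m → z + 1 ≤ W.l (q k) := by
    intro k hk0 hk
    induction hk using Nat.decreasingInduction with
    | self => rw [hqm, W.left_c]; exact hzR
    | of_succ k hk ih =>
      have h1 := hq.1 k hk
      have h3 := hqL k hk.le
      by_contra! hlt
      have := hgap _ (hqA k hk0 hk.le) (by omega) (by have := ih (by omega); omega)
      omega
  rcases lt_or_ge (W.r W.x) (W.l (q 1)) with hx1 | hx1
  · refine h.hasObstruction_of_apex hz hpz hd hdL hdR (hqA 1 one_pos (by omega))
      (hqz 1 one_pos (by omega)) hx1 ?_ (hqR 1 (by omega))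
    rw [← hq0]
    exact hq.1 0 (by omega)
  obtain ⟨j, hjm, hj⟩ := hq.exists_last hqlr (a := W.r W.x)
    (by rw [hq0]; have := W.left_y_le; omega)
    (by rw [hqm, hc]; exact hrx)
  have hj1 := (hj 1 (by omega)).1 hx1
  have hjx := (hj j hjm.le).2 le_rfl
  have hjx' := (hj (j + 1) hjm).not.2 (by omega)
  have hjq := hq.1 j hjm
  have hp1 : W.l W.x ≤ W.r (p 1) := by
    have := h.chain.1 0 (by omega)
    rw [h.zero] at this
    exact neg_le_neg_iff.1 this
  have hp12 := (h.isInducedPath 1 2 (by omega) hn).2.2 rfl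
  have hp01 := (h.isInducedPath 0 1 (by omega) (by omega)).2.2 rfl
  have hp02 := (h.isInducedPath 0 2 (by omega) hn).2.not.2 (by omega)
  rw [h.zero] at hp01 hp02
  have hp1z := hpz 1 (by omega) (by omega)
  have hp2z := hpz 2 (by omega) (by omega)
  have hq1z := hqz j (by omega) (by omega)
  have hq2z := hqz (j + 1) (by omega) (by omega)
  have hp1A := h.mem 1 (by omega) (by omega)
  have hp2A := h.mem 2 (by omega) (by omega)
  have hq1A := hqA j (by omega) (by omega)
  have hq2A := hqA (j + 1) (by omega) (by omega)
  have hq1lr := hqlr j (by omega)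
  have hq2lr := hqlr (j + 1) (by omega)
  have hsep : ∀ k, 0 < k → k ≤ n → ∀ k', 0 < k' → k' ≤ m → ¬ G.Adj (p k) (q k') := by
    intro k hk0 hk k' hk0' hk'
    have h1 := hpz k hk0 hk
    have h2 := hqz k' hk0' hk'
    have h3 := h.lr k hk
    rw [W.adj_iff _ (h.memA k hk) _ (hqA k' hk0' hk').1 (by intro he; rw [he] at h1 h3; omega)]
    omega
  have hdq : ∀ k, 0 < k → k ≤ m → G.Adj d (q k) := by
    intro k hk0 hk
    have h1 := hqz k hk0 hk
    have h2 := hqR k hk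
    have h3 := hqlr k hk
    have h4 := hqL k hk
    rw [W.adj_iff d hd.1 _ (hqA k hk0 hk).1 (by rintro rfl; omega)]
    omega
  refine Or.inr (Or.inl (hasInduced_umbrella (a := p 2) (b := p 1) (c := W.x) (d := q j)
    (e := q (j + 1)) (h := d) (t := W.v) ?_ (h.adj_hub hd hdL hdR hn)
    (h.adj_hub hd hdL hdR (by omega)) ?_ (hdq _ (by omega) (by omega)) (hdq _ (by omega) (by omega))
    (adj_v_of_mem W.hx) (not_adj_v hp2A) (not_adj_v hp1A) (not_adj_v hq1A) (not_adj_v hq2A)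
    (not_adj_v hd)))
  · refine ⟨hp12.symm, hp01.symm, ?_, ?_, fun hh => hp02 hh.symm,
      hsep _ (by omega) (by omega) _ (by omega) (by omega),
      hsep _ (by omega) (by omega) _ (by omega) (by omega),
      hsep _ (by omega) (by omega) _ (by omega) (by omega),
      hsep _ (by omega) (by omega) _ (by omega) (by omega), ?_⟩
    · rw [adj_C_iff W.hx hq1A]; omega
    · rw [W.adj_iff _ hq1A.1 _ hq2A.1 (hq.ne_succ hm hjm)]
      exact ⟨hq.left_le_right_succ hqlr hm hjm, hjq⟩
    · rw [adj_C_iff W.hx hq2A]; omega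
  · rw [G.adj_comm, adj_C_iff W.hx hd]; omega

theorem hasObstruction_of_lt_left [Finite V] (hx : W.L < W.l W.x) : HasObstruction G := by
  by_cases hD : ∀ z, W.L ≤ z → z < W.R →
      ∃ f ∈ {f ∈ W.A \ W.C | ¬ (W.l f ≤ W.L ∧ W.R ≤ W.r f)}, W.l f ≤ z ∧ z + 1 ≤ W.r f
  swap
  · obtain ⟨z, hz'⟩ := not_forall.1 hD
    obtain ⟨hz, hz'⟩ := Classical.not_imp.1 hz'
    obtain ⟨hzR, hno⟩ := Classical.not_imp.1 hz'
    refine hasObstruction_of_gap hx hz hzR fun f hf h1 h2 => ?_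
    by_contra hh
    exact hno ⟨f, ⟨hf, hh⟩, h1, h2⟩
  obtain ⟨n, p, h, hp⟩ := exists_isSpine (fun f hf => hf.1) hD
  have h1 := W.left_x_le
  have h2 := W.le_right_x
  have h3 := W.left_y_le
  have h4 := W.le_right_y
  have h5 := W.left_y
  have h6 := W.right_x
  have h7 := W.L_lt
  have h8 := W.lt_R
  have hn := h.two_le
  have hp0 := W.right_b
  have hpn := W.left_c
  rw [← h.zero] at hp0
  rw [← h.last] at hpn
  obtain ⟨j, k, hj1, hjk, hkn, hj, hk⟩ := h.exists_range W.hx hx W.right_x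
  rcases hjk.lt_or_eq with hjk | rfl
  · exact h.hasObstruction W.hx hj1 hjk hkn hj hk
  have hxp : ∀ m ≤ n, G.Adj W.x (p m) ↔ m = j := fun m hm => by
    rw [adj_C_iff W.hx (h.mem m hm), hj m hm, hk m hm]
    omega
  have hvp : ∀ m ≤ n, ¬ G.Adj W.v (p m) := fun m hm => not_adj_v (h.mem m hm)
  have hpp := fun a b hab hb => (h.isInducedPath a b hab hb).2
  have hjl := h.chain.1 (j - 1) (by omega)
  rw [Nat.sub_add_cancel hj1] at hjl
  have hjr := h.chain.1 j hkn
  have hjx := (hj (j - 1) (by omega)).not.2 (by omega)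
  have hxj := (hk (j + 1) (by omega)).not.2 (by omega)
  rcases (by omega : j = 1 ∨ 2 ≤ j ∧ j + 1 = n ∨ 2 ≤ j ∧ j + 2 ≤ n) with
    rfl | ⟨hj2, rfl⟩ | ⟨hj2, hjn⟩
  · have hn3 : 3 ≤ n := by
      by_contra! hn3
      obtain rfl : n = 2 := by omega
      exact (hp 1 one_pos one_lt_two).2 ⟨by rw [← hp0]; exact hjl, by rw [← hpn]; exact hjr⟩
    have hp3 := h.chain.2 1 3 le_rfl hn3
    have hl3 := h.left_le hn3
    simp only [Nat.sub_self, Nat.reduceAdd] at hjl hjr hjx hxj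
    by_cases hy : W.r W.y < W.R
    · obtain ⟨j, k, hj1, hjk, hkn, hj', hk'⟩ := h.exists_range W.hy h5 hy
      rcases hjk.lt_or_eq with hjk | rfl
      · exact h.hasObstruction W.hy hj1 hjk hkn hj' hk'
      · have hj2 := (hj' 1 (by omega)).1 (by omega)
        obtain rfl : j = 1 := by omega
        have := (hk' 2 (by omega)).not.2 (by omega)
        exact hasObstruction_of_hub (W := W.mirror) (d := p 1) (neg_lt_neg hy) (h.mem 1 (by omega))
          (neg_lt_neg (by omega)) (neg_le_neg (show W.r W.y ≤ W.r (p 1) by omega))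
          (neg_le_neg (by omega))
    · have hyp : ∀ m ≤ n, G.Adj W.y (p m) ↔ 1 ≤ m := fun m hm => by
        rw [adj_C_iff W.hy (h.mem m hm)]
        have := h.left_le hm
        have h9 := hj m hm
        rcases Nat.eq_zero_or_pos m with rfl | hm0
        · omega
        · rcases (by omega : m = 1 ∨ 2 ≤ m) with rfl | hm2
          · omega
          · have h10 := h.chain.2 0 m hm2 hm
            have h11 := h.lr m hm
            have h12 := (hk m hm).not.2 (by omega)
            omega
      have hxy : W.y ≠ W.x := by
        intro he
        rw [he] at hy
        exact hy h6
      refine Or.inr (Or.inl (hasInduced_umbrella (a := W.v) (b := W.x) (c := p 1) (d := p 2)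
        (e := p 3) (h := W.y) (t := p 0) ?_ (adj_v_of_mem W.hy).symm (adj_of_mem_C W.hy W.hx hxy)
        ?_ ?_ ?_ ?_ (fun hh => hvp 0 (by omega) hh.symm) ?_ ?_ ?_ ?_))
      · exact ⟨adj_v_of_mem W.hx, (hxp 1 (by omega)).2 rfl, (hpp 1 2 (by omega) (by omega)).2 rfl,
          (hpp 2 3 (by omega) (by omega)).2 rfl, hvp _ (by omega), hvp _ (by omega),
          hvp _ (by omega), (hxp 2 (by omega)).not.2 (by omega),
          (hxp 3 (by omega)).not.2 (by omega), (hpp 1 3 (by omega) (by omega)).not.2 (by omega)⟩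
      · exact (hyp 1 (by omega)).2 le_rfl
      · exact (hyp 2 (by omega)).2 (by omega)
      · exact (hyp 3 (by omega)).2 (by omega)
      · exact (hpp 0 1 (by omega) (by omega)).2 rfl
      · rw [G.adj_comm]; exact (hxp 0 (by omega)).not.2 (by omega)
      · exact (hpp 0 2 (by omega) (by omega)).not.2 (by omega)
      · exact (hpp 0 3 (by omega) (by omega)).not.2 (by omega)
      · rw [G.adj_comm]; exact (hyp 0 (by omega)).not.2 (by omega)
  · refine hasObstruction_of_hub hx (h.mem j hkn.le) ?_ (by omega) (by omega)
    have := h.chain.2 0 j (by omega) hkn.le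
    omega
  · obtain ⟨j, rfl⟩ : ∃ j', j = j' + 2 := ⟨j - 2, by omega⟩
    refine Or.inl (hasInduced_bipartiteClaw (a := p j) (b := p (j + 1)) (c := p (j + 2))
      (d := p (j + 3)) (e := p (j + 4)) (u := W.x) (v := W.v) ?_ ?_ ?_ ?_ ?_ ?_
      (adj_v_of_mem W.hx).symm (hvp _ (by omega)) (hvp _ (by omega)) (hvp _ (by omega))
      (hvp _ (by omega)) (hvp _ (by omega)))
    · constructor <;> rw [hpp _ _ (by omega) (by omega)]; all_goals omega
    all_goals first
      | exact (hxp _ (by omega)).2 rfl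
      | exact (hxp _ (by omega)).not.2 (by omega)

/-- Every obstructed window yields an obstruction. -/
theorem hasObstruction [Finite V] (W : ObstructedWindow G) : HasObstruction G := by
  by_cases hx : W.L < W.l W.x
  · exact hasObstruction_of_lt_left hx
  by_cases hy : W.r W.y < W.R
  · exact hasObstruction_of_lt_left (W := W.mirror) (neg_lt_neg hy)
  · exact hasObstruction_of_left_le_of_le_right (not_lt.1 hx) (not_lt.1 hy)

end ObstructedWindow

/-- The bags `P 0, …, P N` are cliques covering the vertices and edges of `G` on `A`, and the bags
containing a given vertex are consecutive. -/
structure IsCliquePath {V : Type*} (G : SimpleGraph V) (A : Set V) (N : ℕ) (P : ℕ → Set V) :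
    Prop where
  subset : ∀ y ≤ N, P y ⊆ A
  isClique : ∀ y ≤ N, G.IsClique (P y)
  inter_subset : ∀ i j k, i ≤ j → j ≤ k → k ≤ N → P i ∩ P k ⊆ P j
  exists_mem : ∀ u ∈ A, ∃ y ≤ N, u ∈ P y
  exists_adj : ∀ u ∈ A, ∀ w ∈ A, G.Adj u w → ∃ y ≤ N, u ∈ P y ∧ w ∈ P y

namespace IsCliquePath

variable {V : Type*} {G : SimpleGraph V} {A : Set V} {N : ℕ} {P : ℕ → Set V}

theorem exists_ends (h : IsCliquePath G A N P) :
    ∃ l r : V → ℕ, ∀ u ∈ A, l u ≤ r u ∧ r u ≤ N ∧ ∀ y ≤ N, u ∈ P y ↔ l u ≤ y ∧ y ≤ r u := by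
  have hu : ∀ u : V, ∃ lr : ℕ × ℕ, u ∈ A →
      lr.1 ≤ lr.2 ∧ lr.2 ≤ N ∧ ∀ y ≤ N, u ∈ P y ↔ lr.1 ≤ y ∧ y ≤ lr.2 := by
    classical
    intro u
    by_cases huA : u ∈ A
    swap
    · exact ⟨0, fun h => absurd h huA⟩
    have hS : (Finset.filter (fun y => u ∈ P y) (Finset.range (N + 1))).Nonempty := by
      obtain ⟨y, hy, huy⟩ := h.exists_mem u huA
      exact ⟨y, by simp [huy, hy]⟩
    have hmin := Finset.min'_mem _ hS
    have hmax := Finset.max'_mem _ hS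
    have hle := Finset.min'_le _ _ hmax
    have hminle := Finset.min'_le (Finset.filter (fun y => u ∈ P y) (Finset.range (N + 1)))
    have hlemax := Finset.le_max' (Finset.filter (fun y => u ∈ P y) (Finset.range (N + 1)))
    simp only [Finset.mem_filter, Finset.mem_range, Nat.lt_succ_iff] at hmin hmax hminle hlemax
    refine ⟨(_, _), fun _ => ⟨hle, hmax.1, fun y hy => ⟨fun huy => ⟨hminle y ⟨hy, huy⟩,
      hlemax y ⟨hy, huy⟩⟩, fun hy' => h.inter_subset _ y _ hy'.1 hy'.2 hmax.1 ⟨hmin.2, hmax.2⟩⟩⟩⟩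
  choose lr hlr using hu
  exact ⟨fun u => (lr u).1, fun u => (lr u).2, hlr⟩

theorem adj_iff (h : IsCliquePath G A N P) {l r : V → ℕ}
    (hlr : ∀ u ∈ A, l u ≤ r u ∧ r u ≤ N ∧ ∀ y ≤ N, u ∈ P y ↔ l u ≤ y ∧ y ≤ r u)
    {u w : V} (hu : u ∈ A) (hw : w ∈ A) (huw : u ≠ w) :
    G.Adj u w ↔ l u ≤ r w ∧ l w ≤ r u := by
  obtain ⟨hu1, hu2, hu3⟩ := hlr u hu
  obtain ⟨hw1, hw2, hw3⟩ := hlr w hw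
  constructor
  · intro hadj
    obtain ⟨y, hy, huy, hwy⟩ := h.exists_adj u hu w hw hadj
    rw [hu3 y hy] at huy
    rw [hw3 y hy] at hwy
    omega
  · intro hov
    have hy : max (l u) (l w) ≤ N := by omega
    exact h.isClique _ hy ((hu3 _ hy).2 (by omega)) ((hw3 _ hy).2 (by omega)) huw

/-- Helly property: a clique lies in some bag. -/
theorem exists_subset_of_isClique [Finite V] (h : IsCliquePath G A N P) {C : Set V} (hCA : C ⊆ A)
    (hC : G.IsClique C) : ∃ i ≤ N, C ⊆ P i := by
  obtain ⟨l, r, hlr⟩ := h.exists_ends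
  rcases C.eq_empty_or_nonempty with rfl | hne
  · exact ⟨0, Nat.zero_le _, Set.empty_subset _⟩
  obtain ⟨w, hw, hmax⟩ := Set.exists_max_image C l (Set.toFinite _) hne
  obtain ⟨h1, h2, -⟩ := hlr w (hCA hw)
  refine ⟨l w, by omega, fun u hu => ?_⟩
  obtain ⟨h3, h4, h5⟩ := hlr u (hCA hu)
  refine (h5 _ (by omega)).2 ⟨hmax u hu, ?_⟩
  rcases eq_or_ne u w with rfl | huw
  · exact h1
  · exact ((h.adj_iff hlr (hCA hu) (hCA hw) huw).1 (hC hu hw huw)).2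

/-- A bag contained in another one can be dropped. -/
theorem drop (h : IsCliquePath G A (N + 1) P) {d e : ℕ} (hd : d ≤ N + 1) (he : e ≤ N + 1)
    (hde : d ≠ e) (hsub : P d ⊆ P e) :
    IsCliquePath G A N (fun j => P (if j < d then j else j + 1)) := by
  have hle : ∀ j ≤ N, (if j < d then j else j + 1) ≤ N + 1 := fun j hj => by split_ifs <;> omega
  have hex : ∀ y ≤ N + 1, ∃ j ≤ N, P y ⊆ P (if j < d then j else j + 1) := by
    have hne : ∀ y ≤ N + 1, y ≠ d → ∃ j ≤ N, P y ⊆ P (if j < d then j else j + 1) := by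
      intro y hy hyd
      rcases hyd.lt_or_gt with hlt | hlt
      · exact ⟨y, by omega, by rw [if_pos hlt]⟩
      · refine ⟨y - 1, by omega, ?_⟩
        rw [if_neg (by omega), Nat.sub_add_cancel (by omega)]
    intro y hy
    by_cases hyd : y = d
    · obtain ⟨j, hj, hj'⟩ := hne e he hde.symm
      exact ⟨j, hj, hyd ▸ hsub.trans hj'⟩
    · exact hne y hy hyd
  refine ⟨fun y hy => h.subset _ (hle y hy), fun y hy => h.isClique _ (hle y hy),
    fun i j k hij hjk hk => h.inter_subset _ _ _ ?_ ?_ (hle k hk), fun u hu => ?_,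
    fun u hu w hw huw => ?_⟩
  · split_ifs <;> omega
  · split_ifs <;> omega
  · obtain ⟨y, hy, huy⟩ := h.exists_mem u hu
    obtain ⟨j, hj, hj'⟩ := hex y hy
    exact ⟨j, hj, hj' huy⟩
  · obtain ⟨y, hy, huy, hwy⟩ := h.exists_adj u hu w hw huw
    obtain ⟨j, hj, hj'⟩ := hex y hy
    exact ⟨j, hj, hj' huy, hj' hwy⟩

theorem exists_irredundant (h : IsCliquePath G A N P) : ∃ N' P', IsCliquePath G A N' P' ∧
    ∀ d ≤ N', ∀ e ≤ N', d ≠ e → ¬ P' d ⊆ P' e := by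
  induction N generalizing P with
  | zero => exact ⟨0, P, h, fun d hd e he hde => absurd hde (by omega)⟩
  | succ N ih =>
    by_cases hex : ∃ d ≤ N + 1, ∃ e ≤ N + 1, d ≠ e ∧ P d ⊆ P e
    · obtain ⟨d, hd, e, he, hde, hsub⟩ := hex
      exact ih (h.drop hd he hde hsub)
    · exact ⟨N + 1, P, h, fun d hd e he hde hsub => hex ⟨d, hd, e, he, hde, hsub⟩⟩

end IsCliquePath

/-- The bags in `𝓑` can be listed from `p` to `q` such that each vertex occurs consecutively. -/
def HasArrangement {V : Type*} (𝓑 : Set (Set V)) (p q : Set V) : Prop :=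
  ∃ (n : ℕ) (f : ℕ → Set V), f 0 = p ∧ f n = q ∧ (∀ X, X ∈ 𝓑 ↔ ∃ j ≤ n, f j = X) ∧
    ∀ i j k, i ≤ j → j ≤ k → k ≤ n → f i ∩ f k ⊆ f j

namespace HasArrangement

variable {V : Type*} {𝓑 𝓒 : Set (Set V)} {p q t u : Set V}

theorem singleton (p : Set V) : HasArrangement {p} p p :=
  ⟨0, fun _ => p, rfl, rfl, fun X => by simp [eq_comm], fun _ _ _ _ _ _ => by simp⟩

theorem reverse (h : HasArrangement 𝓑 p q) : HasArrangement 𝓑 q p := by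
  obtain ⟨n, f, h0, hn, hf, hc⟩ := h
  refine ⟨n, fun j => f (n - j), by simpa, by simpa, fun X => (hf X).trans ⟨?_, ?_⟩,
    fun i j k hij hjk hk => ?_⟩
  · rintro ⟨j, hj, rfl⟩
    exact ⟨n - j, by omega, congrArg f (by omega)⟩
  · rintro ⟨j, hj, rfl⟩
    exact ⟨n - j, by omega, rfl⟩
  · rw [Set.inter_comm]
    exact hc _ _ _ (by omega) (by omega) (by omega)

theorem glue (h₁ : HasArrangement 𝓑 p t) (h₂ : HasArrangement 𝓒 u q)
    (h : ∀ X ∈ 𝓑, ∀ Y ∈ 𝓒, X ∩ Y ⊆ t ∩ u) : HasArrangement (𝓑 ∪ 𝓒) p q := by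
  obtain ⟨n, f, hf0, hfn, hf, hfc⟩ := h₁
  obtain ⟨m, g, hg0, hgm, hg, hgc⟩ := h₂
  have e1 : ∀ j ≤ n, (if j ≤ n then f j else g (j - (n + 1))) = f j := fun j hj => if_pos hj
  have e2 : ∀ j, n < j → (if j ≤ n then f j else g (j - (n + 1))) = g (j - (n + 1)) :=
    fun j hj => if_neg (by omega)
  refine ⟨n + 1 + m, fun j => if j ≤ n then f j else g (j - (n + 1)), by simpa, ?_,
    fun X => ⟨?_, ?_⟩, fun i j k hij hjk hk => ?_⟩
  · exact (e2 _ (by omega)).trans (by rw [Nat.add_sub_cancel_left, hgm])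
  · rintro (hX | hX)
    · obtain ⟨j, hj, rfl⟩ := (hf X).1 hX
      exact ⟨j, by omega, e1 j hj⟩
    · obtain ⟨j, hj, rfl⟩ := (hg X).1 hX
      exact ⟨n + 1 + j, by omega, (e2 _ (by omega)).trans (by rw [Nat.add_sub_cancel_left])⟩
  · rintro ⟨j, hj, rfl⟩
    rcases le_or_gt j n with hjn | hjn
    · exact Or.inl ((hf _).2 ⟨j, hjn, (e1 j hjn).symm⟩)
    · exact Or.inr ((hg _).2 ⟨j - (n + 1), by omega, (e2 j hjn).symm⟩)
  · rcases le_or_gt k n with hkn | hkn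
    · simp only [e1 i (by omega), e1 j (by omega), e1 k hkn]
      exact hfc i j k hij hjk hkn
    rcases le_or_gt i n with hin | hin
    swap
    · simp only [e2 i hin, e2 j (by omega), e2 k hkn]
      exact hgc _ _ _ (by omega) (by omega) (by omega)
    simp only [e1 i hin, e2 k hkn]
    intro a ha
    obtain ⟨hat, hau⟩ := h _ ((hf _).2 ⟨i, hin, rfl⟩) _ ((hg _).2 ⟨k - (n + 1), by omega, rfl⟩) ha
    rcases le_or_gt j n with hjn | hjn
    · simp only [e1 j hjn]
      exact hfc i j n hij hjn le_rfl ⟨ha.1, hfn ▸ hat⟩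
    · simp only [e2 j hjn]
      exact hgc 0 _ (k - (n + 1)) (Nat.zero_le _) (by omega) (by omega) ⟨hg0 ▸ hau, ha.2⟩

theorem range {P : ℕ → Set V} {N L R : ℕ}
    (hP : ∀ i j k, i ≤ j → j ≤ k → k ≤ N → P i ∩ P k ⊆ P j) (hLR : L ≤ R) (hR : R ≤ N) :
    HasArrangement {X | ∃ y, L ≤ y ∧ y ≤ R ∧ P y = X} (P L) (P R) := by
  refine ⟨R - L, fun j => P (L + j), rfl, ?_, fun X => ⟨?_, ?_⟩, fun i j k hij hjk hk =>
    hP _ _ _ (by omega) (by omega) (by omega)⟩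
  · simp only [Nat.add_sub_cancel' hLR]
  · rintro ⟨y, hLy, hyR, rfl⟩
    exact ⟨y - L, by omega, congrArg P (Nat.add_sub_cancel' hLy)⟩
  · rintro ⟨j, hj, rfl⟩
    exact ⟨L + j, by omega, by omega, rfl⟩

end HasArrangement

/-- The bags `P y` with `L ≤ y ≤ R`. -/
def bagRange {V : Type*} (P : ℕ → Set V) (L R : ℕ) : Set (Set V) :=
  {X | ∃ y, L ≤ y ∧ y ≤ R ∧ P y = X}

theorem bagRange_union {V : Type*} (P : ℕ → Set V) {L y R : ℕ} (hL : L ≤ y) (hR : y < R) :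
    bagRange P L y ∪ bagRange P (y + 1) R = bagRange P L R := by
  ext X
  constructor
  · rintro (⟨z, h1, h2, rfl⟩ | ⟨z, h1, h2, rfl⟩)
    · exact ⟨z, h1, by omega, rfl⟩
    · exact ⟨z, by omega, h2, rfl⟩
  · rintro ⟨z, h1, h2, rfl⟩
    rcases le_or_gt z y with hz | hz
    · exact Or.inl ⟨z, h1, hz, rfl⟩
    · exact Or.inr ⟨z, hz, h2, rfl⟩

/-- A new bag `K` meeting the old bags `P 0, …, P N` within `C ⊆ P i`. -/
structure IsNewBag {V : Type*} (P : ℕ → Set V) (N i : ℕ) (C K : Set V) : Prop where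
  inter_subset : ∀ i j k, i ≤ j → j ≤ k → k ≤ N → P i ∩ P k ⊆ P j
  subset_bag : C ⊆ P i
  subset_new : C ⊆ K
  new_inter : ∀ y ≤ N, K ∩ P y ⊆ C

namespace IsNewBag

variable {V : Type*} {P : ℕ → Set V} {N i : ℕ} {C K : Set V} {L R y : ℕ}

/-- A common element of bags on both sides of the gap after `y` lies in `P y ∩ P (y + 1)`. -/
theorem mem_sep (h : IsNewBag P N i C K) {z z' : ℕ} (hz : z ≤ y) (hz' : y < z') (hN : z' ≤ N)
    {a : V} (ha : a ∈ P z) (ha' : a ∈ P z') : a ∈ P y ∩ P (y + 1) :=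
  ⟨h.inter_subset z y z' hz hz'.le hN ⟨ha, ha'⟩,
    h.inter_subset z (y + 1) z' (by omega) hz' hN ⟨ha, ha'⟩⟩

theorem new_first (h : IsNewBag P N i C K) (hLR : L ≤ R) (hR : R ≤ N) (hCL : C ⊆ P L) :
    HasArrangement ({K} ∪ bagRange P L R) K (P R) := by
  refine (HasArrangement.singleton K).glue (HasArrangement.range h.inter_subset hLR hR) ?_
  rintro _ rfl _ ⟨y, -, hy, rfl⟩ a ha
  exact ⟨ha.1, hCL (h.new_inter y (by omega) ha)⟩

theorem new_last (h : IsNewBag P N i C K) (hLR : L ≤ R) (hR : R ≤ N) (hCR : C ⊆ P R) :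
    HasArrangement ({K} ∪ bagRange P L R) (P L) K := by
  rw [Set.union_comm]
  refine (HasArrangement.range h.inter_subset hLR hR).glue (HasArrangement.singleton K) ?_
  rintro _ ⟨y, -, hy, rfl⟩ _ rfl a ha
  exact ⟨hCR (h.new_inter y (by omega) ha.symm), ha.2⟩

theorem between_of_new_last (h : IsNewBag P N i C K) (hLy : L ≤ y) (hiy : i ≤ y) (hyR : y < R)
    (hR : R ≤ N) (hsep : P y ∩ P (y + 1) ⊆ C)
    (hS : HasArrangement ({K} ∪ bagRange P L y) (P L) K) :
    HasArrangement ({K} ∪ bagRange P L R) (P L) (P R) := by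
  rw [← bagRange_union P hLy hyR, ← Set.union_assoc]
  refine hS.glue (HasArrangement.range h.inter_subset hyR hR) ?_
  rintro _ (rfl | ⟨z, -, hz, rfl⟩) _ ⟨z', hz', hz'R, rfl⟩ a ⟨ha, ha'⟩
  · have haC := h.new_inter z' (by omega) ⟨ha, ha'⟩
    exact ⟨ha, (h.mem_sep hiy hz' (by omega) (h.subset_bag haC) ha').2⟩
  · have := h.mem_sep hz hz' (by omega) ha ha'
    exact ⟨h.subset_new (hsep this), this.2⟩

theorem between_of_new_first (h : IsNewBag P N i C K) (hLy : L ≤ y) (hyi : y < i) (hiR : i ≤ R)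
    (hR : R ≤ N) (hsep : P y ∩ P (y + 1) ⊆ C)
    (hS : HasArrangement ({K} ∪ bagRange P (y + 1) R) K (P R)) :
    HasArrangement ({K} ∪ bagRange P L R) (P L) (P R) := by
  rw [← bagRange_union P hLy (hyi.trans_le hiR), Set.union_left_comm]
  refine (HasArrangement.range h.inter_subset hLy (by omega)).glue hS ?_
  rintro _ ⟨z', hz', hz'R, rfl⟩ _ (rfl | ⟨z, hz, hzR, rfl⟩) a ⟨ha', ha⟩
  · have haC := h.new_inter z' (by omega) ⟨ha, ha'⟩
    exact ⟨(h.mem_sep hz'R hyi (by omega) ha' (h.subset_bag haC)).1, ha⟩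
  · have := h.mem_sep hz'R hz (by omega) ha' ha
    exact ⟨this.1, h.subset_new (hsep this)⟩

theorem new_first_of_new_last (h : IsNewBag P N i C K) (hLy : L ≤ y) (hiy : i ≤ y) (hyR : y < R)
    (hR : R ≤ N) (hsep : P y ∩ P (y + 1) ⊆ P L)
    (hS : HasArrangement ({K} ∪ bagRange P L y) (P L) K) :
    HasArrangement ({K} ∪ bagRange P L R) K (P R) := by
  rw [← bagRange_union P hLy hyR, ← Set.union_assoc]
  refine hS.reverse.glue (HasArrangement.range h.inter_subset hyR hR) ?_
  rintro _ (rfl | ⟨z, -, hz, rfl⟩) _ ⟨z', hz', hz'R, rfl⟩ a ⟨ha, ha'⟩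
  · have haC := h.new_inter z' (by omega) ⟨ha, ha'⟩
    have := h.mem_sep hiy hz' (by omega) (h.subset_bag haC) ha'
    exact ⟨hsep this, this.2⟩
  · have := h.mem_sep hz hz' (by omega) ha ha'
    exact ⟨hsep this, this.2⟩

theorem new_last_of_new_first (h : IsNewBag P N i C K) (hLy : L ≤ y) (hyi : y < i) (hiR : i ≤ R)
    (hR : R ≤ N) (hsep : P y ∩ P (y + 1) ⊆ P R)
    (hS : HasArrangement ({K} ∪ bagRange P (y + 1) R) K (P R)) :
    HasArrangement ({K} ∪ bagRange P L R) (P L) K := by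
  rw [← bagRange_union P hLy (hyi.trans_le hiR), Set.union_left_comm]
  refine (HasArrangement.range h.inter_subset hLy (by omega)).glue hS.reverse ?_
  rintro _ ⟨z', hz', hz'R, rfl⟩ _ (rfl | ⟨z, hz, hzR, rfl⟩) a ⟨ha', ha⟩
  · have haC := h.new_inter z' (by omega) ⟨ha, ha'⟩
    have := h.mem_sep hz'R hyi (by omega) ha' (h.subset_bag haC)
    exact ⟨this.1, hsep this⟩
  · have := h.mem_sep hz'R hz (by omega) ha' ha
    exact ⟨this.1, hsep this⟩

/-- The subproblems `(side, L, R)` reached when trying to arrange `P 0, …, P N` together with the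
new bag: `true` asks to arrange the new bag and `P L, …, P R` starting with the new bag and ending
with `P R`, and `false` asks to start with `P L` and end with the new bag. -/
inductive Reach (P : ℕ → Set V) (N i : ℕ) (C : Set V) : Bool → ℕ → ℕ → Prop
  | first : Reach P N i C true 0 N
  | last : Reach P N i C false 0 N
  | cut_right {y : ℕ} : i ≤ y → y < N → P y ∩ P (y + 1) ⊆ C → Reach P N i C false 0 y
  | cut_left {y : ℕ} : y < i → P y ∩ P (y + 1) ⊆ C → Reach P N i C true (y + 1) N
  | shrink_right {L R y : ℕ} : Reach P N i C true L R → i ≤ y → y < R →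
      P y ∩ P (y + 1) ⊆ P L → Reach P N i C false L y
  | shrink_left {L R y : ℕ} : Reach P N i C false L R → L ≤ y → y < i →
      P y ∩ P (y + 1) ⊆ P R → Reach P N i C true (y + 1) R

theorem Reach.bounds {s : Bool} (hi : i ≤ N) (h : Reach P N i C s L R) :
    L ≤ i ∧ i ≤ R ∧ R ≤ N := by
  induction h <;> omega

theorem Reach.exists_sides {s : Bool} (h : Reach P N i C s L R) :
    (∃ R', Reach P N i C true L R') ∧ ∃ L', Reach P N i C false L' R := by
  induction h with
  | first => exact ⟨⟨N, .first⟩, 0, .last⟩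
  | last => exact ⟨⟨N, .first⟩, 0, .last⟩
  | cut_right h1 h2 h3 => exact ⟨⟨N, .first⟩, 0, .cut_right h1 h2 h3⟩
  | cut_left h1 h2 => exact ⟨⟨N, .cut_left h1 h2⟩, 0, .last⟩
  | shrink_right h h1 h2 h3 ih => exact ⟨ih.1, _, .shrink_right h h1 h2 h3⟩
  | shrink_left h h1 h2 h3 ih => exact ⟨⟨_, .shrink_left h h1 h2 h3⟩, ih.2⟩

/-- If the bags cannot be arranged in any of three ways, there is a window `[L, R]` around `i` none
of whose separators can be used to make room for the new bag. -/
theorem exists_window (h : IsNewBag P N i C K) (hi : i ≤ N)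
    (h₁ : ¬ HasArrangement ({K} ∪ bagRange P 0 N) K (P N))
    (h₂ : ¬ HasArrangement ({K} ∪ bagRange P 0 N) (P 0) K)
    (h₃ : ¬ HasArrangement ({K} ∪ bagRange P 0 N) (P 0) (P N)) :
    ∃ L R, L < i ∧ i < R ∧ R ≤ N ∧ ¬ C ⊆ P L ∧ ¬ C ⊆ P R ∧
      (∀ y, i ≤ y → y < R → ¬ P y ∩ P (y + 1) ⊆ C ∧ ¬ P y ∩ P (y + 1) ⊆ P L) ∧
      ∀ y, L ≤ y → y < i → ¬ P y ∩ P (y + 1) ⊆ C ∧ ¬ P y ∩ P (y + 1) ⊆ P R := by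
  classical
  have hneg : ∀ s L R, Reach P N i C s L R →
      (s = true → ¬ HasArrangement ({K} ∪ bagRange P L R) K (P R)) ∧
      (s = false → ¬ HasArrangement ({K} ∪ bagRange P L R) (P L) K) := by
    intro s L R hr
    induction hr with
    | first => simpa using h₁
    | last => simpa using h₂
    | cut_right h1 h2 h3 =>
      refine ⟨by simp, fun _ hS => h₃ (h.between_of_new_last (Nat.zero_le _) h1 h2 le_rfl h3 hS)⟩
    | cut_left h1 h2 =>
      refine ⟨fun _ hS => h₃ (h.between_of_new_first (Nat.zero_le _) h1 hi le_rfl h2 hS), by simp⟩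
    | shrink_right hr h1 h2 h3 ih =>
      have hb := hr.bounds hi
      exact ⟨by simp, fun _ hS =>
        ih.1 rfl (h.new_first_of_new_last (by omega) h1 h2 hb.2.2 h3 hS)⟩
    | shrink_left hr h1 h2 h3 ih =>
      have hb := hr.bounds hi
      exact ⟨fun _ hS => ih.2 rfl (h.new_last_of_new_first h1 h2 hb.2.1 hb.2.2 h3 hS), by simp⟩
  have hexR : ∃ R, ∃ L, Reach P N i C false L R := ⟨N, 0, .last⟩
  have hexL : ∃ k, ∃ L R, L + k = i ∧ Reach P N i C true L R := ⟨i, 0, N, by omega, .first⟩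
  obtain ⟨L₀, hR⟩ := Nat.find_spec hexR
  obtain ⟨L, R₀, hLk, hL⟩ := Nat.find_spec hexL
  have hminR : ∀ R' L', Reach P N i C false L' R' → Nat.find hexR ≤ R' :=
    fun R' L' h => Nat.find_min' hexR ⟨L', h⟩
  have hmaxL : ∀ L' R', Reach P N i C true L' R' → L' ≤ L := fun L' R' h => by
    have hb := h.bounds hi
    have := Nat.find_min' hexL (m := i - L') ⟨L', R', by omega, h⟩
    omega
  generalize Nat.find hexR = R at hR hminR
  have hbL := hL.bounds hi
  have hbR := hR.bounds hi
  have hRR : R ≤ R₀ := by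
    obtain ⟨L', h'⟩ := hL.exists_sides.2
    exact hminR _ _ h'
  have hLL : L₀ ≤ L := by
    obtain ⟨R', h'⟩ := hR.exists_sides.1
    exact hmaxL _ _ h'
  have hCL : ¬ C ⊆ P L := fun hC =>
    (hneg _ _ _ hL).1 rfl (h.new_first (by omega) hbL.2.2 hC)
  have hCR : ¬ C ⊆ P R := fun hC =>
    (hneg _ _ _ hR).2 rfl (h.new_last (by omega) hbR.2.2 hC)
  refine ⟨L, R, hbL.1.lt_of_ne ?_, hbR.2.1.lt_of_ne ?_, hbR.2.2, hCL, hCR,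
    fun y h1 h2 => ⟨fun hs => ?_, fun hs => ?_⟩, fun y h1 h2 => ⟨fun hs => ?_, fun hs => ?_⟩⟩
  · rintro rfl; exact hCL h.subset_bag
  · rintro rfl; exact hCR h.subset_bag
  · have := hminR _ _ (.cut_right h1 (by omega) hs)
    omega
  · have := hminR _ _ (.shrink_right hL h1 (by omega) hs)
    omega
  · have := hmaxL _ _ (.cut_left h2 hs)
    omega
  · have := hmaxL _ _ (.shrink_left hR (by omega) h2 hs)
    omega

end IsNewBag

theorem HasArrangement.isCliquePath_insert {V : Type*} {G : SimpleGraph V} {A C : Set V} {N i : ℕ}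
    {P : ℕ → Set V} {v : V} (h : IsCliquePath G A N P) (hi : i ≤ N) (hC : C ⊆ P i)
    (hv : ∀ u ∈ A, G.Adj v u ↔ u ∈ C) {p q : Set V}
    (hS : HasArrangement ({insert v C} ∪ bagRange P 0 N) p q) :
    ∃ N' P', IsCliquePath G (insert v A) N' P' := by
  obtain ⟨n, f, -, -, hf, hc⟩ := hS
  have hcases : ∀ y ≤ n, f y = insert v C ∨ ∃ z ≤ N, P z = f y := by
    intro y hy
    rcases (hf (f y)).2 ⟨y, hy, rfl⟩ with h1 | ⟨z, -, hz, h2⟩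
    · exact Or.inl h1
    · exact Or.inr ⟨z, hz, h2⟩
  obtain ⟨k, hk, hfk⟩ := (hf _).1 (Or.inl rfl)
  have hold : ∀ z ≤ N, ∃ y ≤ n, f y = P z := fun z hz =>
    (hf _).1 (Or.inr ⟨z, Nat.zero_le _, hz, rfl⟩)
  have hCA := hC.trans (h.subset i hi)
  refine ⟨n, f, fun y hy => ?_, fun y hy => ?_, hc, ?_, ?_⟩
  · rcases hcases y hy with h1 | ⟨z, hz, h1⟩
    · rw [h1]; exact Set.insert_subset_insert hCA
    · rw [← h1]; exact (h.subset z hz).trans (Set.subset_insert _ _)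
  · rcases hcases y hy with h1 | ⟨z, hz, h1⟩
    · rw [h1]
      exact ((h.isClique i hi).subset hC).insert fun u hu _ => (hv u (hCA hu)).2 hu
    · rw [← h1]; exact h.isClique z hz
  · rintro u (rfl | hu)
    · exact ⟨k, hk, hfk ▸ Set.mem_insert _ _⟩
    · obtain ⟨z, hz, huz⟩ := h.exists_mem u hu
      obtain ⟨y, hy, hfy⟩ := hold z hz
      exact ⟨y, hy, hfy ▸ huz⟩
  · rintro u (rfl | hu) w (rfl | hw) huw
    · exact absurd huw (G.irrefl)
    · exact ⟨k, hk, hfk ▸ Set.mem_insert _ _, hfk ▸ Set.mem_insert_of_mem _ ((hv w hw).1 huw)⟩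
    · exact ⟨k, hk, hfk ▸ Set.mem_insert_of_mem _ ((hv u hu).1 huw.symm), hfk ▸ Set.mem_insert _ _⟩
    · obtain ⟨z, hz, huz, hwz⟩ := h.exists_adj u hu w hw huw
      obtain ⟨y, hy, hfy⟩ := hold z hz
      exact ⟨y, hy, hfy ▸ huz, hfy ▸ hwz⟩

/-- Without obstructions, a vertex whose neighbourhood is a clique can be added to a clique path. -/
theorem IsCliquePath.exists_insert {V : Type*} [Finite V] {G : SimpleGraph V} {A : Set V} {N : ℕ}
    {P : ℕ → Set V} (h : IsCliquePath G A N P) {v : V} (hvA : v ∉ A)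
    (hv : G.IsClique {u ∈ A | G.Adj v u}) (hG : ¬ HasObstruction G) :
    ∃ N' P', IsCliquePath G (insert v A) N' P' := by
  obtain ⟨N, P, h, hirr⟩ := h.exists_irredundant
  obtain ⟨l, r, hlr⟩ := h.exists_ends
  have hCA : {u ∈ A | G.Adj v u} ⊆ A := fun u hu => hu.1
  have hvC : ∀ u ∈ A, G.Adj v u ↔ u ∈ {u ∈ A | G.Adj v u} := fun u hu => by simp [hu]
  generalize {u ∈ A | G.Adj v u} = C at hv hCA hvC
  obtain ⟨i, hi, hC⟩ := h.exists_subset_of_isClique hCA hv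
  have hnew : IsNewBag P N i C (insert v C) := by
    refine ⟨h.inter_subset, hC, Set.subset_insert _ _, ?_⟩
    rintro y hy a ⟨rfl | ha, ha'⟩
    · exact absurd (h.subset y hy ha') hvA
    · exact ha
  by_contra hno
  obtain ⟨L, R, hLi, hiR, hRN, hCL, hCR, hright, hleft⟩ := hnew.exists_window hi
    (fun hS => hno (hS.isCliquePath_insert h hi hC hvC))
    (fun hS => hno (hS.isCliquePath_insert h hi hC hvC))
    (fun hS => hno (hS.isCliquePath_insert h hi hC hvC))
  have hmem : ∀ u ∈ A, ∀ y ≤ N, u ∈ P y ↔ l u ≤ y ∧ y ≤ r u := fun u hu => (hlr u hu).2.2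
  have hCi : ∀ u ∈ C, l u ≤ i ∧ i ≤ r u := fun u hu => (hmem u (hCA hu) i hi).1 (hC hu)
  obtain ⟨b, hbL, hbL'⟩ := Set.not_subset.1 (hirr L (by omega) (L + 1) (by omega) (by omega))
  obtain ⟨c, hcR, hcR'⟩ := Set.not_subset.1 (hirr R hRN (R - 1) (by omega) (by omega))
  have hbA := h.subset _ (by omega) hbL
  have hcA := h.subset _ hRN hcR
  rw [hmem b hbA _ (by omega)] at hbL hbL'
  rw [hmem c hcA _ (by omega)] at hcR hcR'
  have hxne : {u ∈ C | r u < R}.Nonempty := by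
    obtain ⟨u, hu, huR⟩ := Set.not_subset.1 hCR
    have := hCi u hu
    rw [hmem u (hCA hu) _ hRN] at huR
    exact ⟨u, hu, by omega⟩
  have hyne : {u ∈ C | L < l u}.Nonempty := by
    obtain ⟨u, hu, huL⟩ := Set.not_subset.1 hCL
    have := hCi u hu
    rw [hmem u (hCA hu) _ (by omega)] at huL
    exact ⟨u, hu, by omega⟩
  obtain ⟨x, ⟨hx, hxR⟩, hxmin⟩ := Set.exists_min_image _ l (Set.toFinite _) hxne
  obtain ⟨y, ⟨hy, hyL⟩, hymax⟩ := Set.exists_max_image _ r (Set.toFinite _) hyne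
  refine hG (ObstructedWindow.hasObstruction
    { A := A, C := C, v := v, b := b, c := c, x := x, y := y
      l := fun u => l u, r := fun u => r u, L := L, i := i, R := R
      left_le_right := fun u hu => by exact_mod_cast (hlr u hu).1
      adj_iff := fun u hu w hw huw => by exact_mod_cast h.adj_iff hlr hu hw huw
      adj_v := hvC
      C_subset := hCA
      left_C := fun u hu => by exact_mod_cast (hCi u hu).1
      right_C := fun u hu => by exact_mod_cast (hCi u hu).2
      L_lt := by exact_mod_cast hLi
      lt_R := by exact_mod_cast hiR
      hb := ⟨hbA, fun hbC => by have := hCi b hbC; omega⟩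
      hc := ⟨hcA, fun hcC => by have := hCi c hcC; omega⟩
      right_b := by omega
      left_c := by omega
      hx := hx
      right_x := by exact_mod_cast hxR
      min_x := fun u hu huR => by exact_mod_cast hxmin u ⟨hu, by exact_mod_cast huR⟩
      hy := hy
      left_y := by exact_mod_cast hyL
      max_y := fun u hu huL => by exact_mod_cast hymax u ⟨hu, by exact_mod_cast huL⟩
      cover := fun z hz1 hz2 => ?_
      cover_left := fun z hz1 hz2 => ?_
      cover_right := fun z hz1 hz2 => ?_ })
  all_goals lift z to ℕ using by omega
  all_goals norm_cast at hz1 hz2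
  · have hs : ¬ P z ∩ P (z + 1) ⊆ C := by
      rcases lt_or_ge z i with hzi | hzi
      · exact (hleft z hz1 hzi).1
      · exact (hright z hzi hz2).1
    obtain ⟨f, ⟨hf1, hf2⟩, hfC⟩ := Set.not_subset.1 hs
    have hfA := h.subset _ (by omega) hf1
    rw [hmem f hfA _ (by omega)] at hf1 hf2
    exact ⟨f, ⟨hfA, hfC⟩, by omega, by omega⟩
  · obtain ⟨f, ⟨hf1, hf2⟩, hfR⟩ := Set.not_subset.1 (hleft z hz1 hz2).2
    have hfA := h.subset _ (by omega) hf1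
    rw [hmem f hfA _ (by omega)] at hf1 hf2 hfR
    exact ⟨f, hfA, by omega, by omega, by omega⟩
  · obtain ⟨f, ⟨hf1, hf2⟩, hfL⟩ := Set.not_subset.1 (hright z hz1 hz2).2
    have hfA := h.subset _ (by omega) hf1
    rw [hmem f hfA _ (by omega)] at hf1 hf2 hfL
    exact ⟨f, hfA, by omega, by omega, by omega⟩

/-- The edges of `G` with both ends in `W`, as a graph on all the vertices. -/
def edgesInside {V : Type*} (G : SimpleGraph V) (W : Set V) : SimpleGraph V where
  Adj u w := G.Adj u w ∧ u ∈ W ∧ w ∈ W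
  symm := ⟨fun _ _ h => ⟨h.1.symm, h.2.2, h.2.1⟩⟩
  loopless := ⟨fun _ h => G.irrefl h.1⟩

section Simplicial

variable {V : Type*} {G : SimpleGraph V} {W : Set V}

theorem edgesInside_mono {W' : Set V} (h : W ⊆ W') : edgesInside G W ≤ edgesInside G W' :=
  fun _ _ huw => ⟨huw.1, h huw.2.1, h huw.2.2⟩

theorem mem_of_reachable_edgesInside {x y : V} (hx : x ∈ W)
    (h : (edgesInside G W).Reachable x y) : y ∈ W := by
  rw [reachable_iff_reflTransGen] at h
  induction h with
  | refl => exact hx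
  | tail _ h _ => exact h.2.2

theorem reachable_edgesInside_component {x y : V} (h : (edgesInside G W).Reachable x y) :
    (edgesInside G {t | (edgesInside G W).Reachable x t}).Reachable x y := by
  rw [reachable_iff_reflTransGen] at h
  induction h with
  | refl => rfl
  | tail hb h ih =>
    rw [← reachable_iff_reflTransGen] at hb
    exact ih.trans (Adj.reachable ⟨h.1, hb, hb.trans (Adj.reachable h)⟩)

theorem exists_isInducedPath_of_reachable {x y : V} (hxy : x ≠ y)
    (h : (edgesInside G W).Reachable x y) :
    ∃ n p, IsInducedPath G n p ∧ p 0 = x ∧ p n = y ∧ ∀ i ≤ n, p i ∈ W := by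
  obtain ⟨w, hw⟩ := h.exists_walk_length_eq_dist
  have hx : x ∈ W := by
    cases w with
    | nil => exact absurd rfl hxy
    | cons h _ => exact h.2.1
  have hadj : ∀ i < w.length, (edgesInside G W).Adj (w.getVert i) (w.getVert (i + 1)) :=
    fun i hi => w.adj_getVert_succ hi
  have hmem : ∀ i, w.getVert i ∈ W :=
    fun i => mem_of_reachable_edgesInside hx (w.take i).reachable
  have hlen : ∀ i j, i ≤ j → j ≤ w.length →
      ∀ q : (edgesInside G W).Walk (w.getVert i) (w.getVert j), j ≤ i + q.length := by
    intro i j hij hj q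
    have := dist_le (((w.take i).append q).append (w.drop j))
    simp only [Walk.length_append, Walk.take_length, Walk.drop_length] at this
    omega
  refine ⟨w.length, w.getVert, fun i j hij hj => ⟨fun heq => ?_, fun hG => ?_, ?_⟩,
    w.getVert_zero, w.getVert_length, fun i _ => hmem i⟩
  · have := hlen i j hij.le hj (Walk.nil.copy rfl heq)
    simp at this
    omega
  · have := hlen i j hij.le hj
      (Walk.cons (show (edgesInside G W).Adj _ _ from ⟨hG, hmem i, hmem j⟩) Walk.nil)
    simp at this
    omega
  · rintro rfl
    exact (hadj i (by omega)).1

theorem not_reachable_edgesInside_of_chordal (hG : ∀ m, 4 ≤ m → ¬ HasInduced (cycG m) G)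
    {x y z : V} (hW : ∀ t ∈ W, t ≠ z ∧ ¬ G.Adj z t) (hx : G.Adj z x) (hy : G.Adj z y)
    (hxy : x ≠ y) (hnadj : ¬ G.Adj x y) :
    ¬ (edgesInside G (insert x (insert y W))).Reachable x y := by
  intro h
  obtain ⟨n, p, hp, hp0, hpn, hmem⟩ := exists_isInducedPath_of_reachable hxy h
  have hn : 2 ≤ n := by
    rcases n with _ | _ | n
    · exact absurd (hp0.symm.trans hpn) hxy
    · exact absurd (hp0 ▸ hpn ▸ (hp 0 1 (by omega) le_rfl).2.2 rfl) hnadj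
    · omega
  have hz : ∀ i ≤ n, p i ≠ z ∧ (G.Adj (p i) z ↔ i = 0 ∨ i = n) := by
    intro i hi
    rcases Nat.eq_zero_or_pos i with rfl | h0
    · rw [hp0]
      exact ⟨hx.ne', by simp [hx.symm]⟩
    rcases hi.eq_or_lt with rfl | hin
    · rw [hpn]
      exact ⟨hy.ne', by simp [hy.symm]⟩
    have hpW : p i ∈ W := by
      rcases hmem i hi with h1 | h1 | h1
      · exact absurd (hp0.trans h1.symm) (hp 0 i h0 hi).1
      · exact absurd (h1.trans hpn.symm) (hp i n hin le_rfl).1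
      · exact h1
    refine ⟨(hW _ hpW).1, iff_of_false (fun h => (hW _ hpW).2 h.symm) (by omega)⟩
  refine hG (n + 2) (by omega) (hasInduced_of_lt
    (fun i => if i.val ≤ n then p i.val else z) fun ⟨i, hi⟩ ⟨j, hj⟩ hij => ?_)
  simp only [Fin.mk_lt_mk] at hij
  have hi' : i ≤ n := by omega
  simp only [cycG, fromRel_adj, ne_eq, Fin.mk.injEq, hi', if_true]
  rw [Nat.mod_eq_of_lt (show i + 1 < n + 2 by omega)]
  by_cases hjn : j ≤ n
  · rw [if_pos hjn, Nat.mod_eq_of_lt (show j + 1 < n + 2 by omega)]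
    refine ⟨(hp i j hij hjn).1, (hp i j hij hjn).2.trans (by omega)⟩
  · obtain rfl : j = n + 1 := by omega
    rw [if_neg hjn, Nat.mod_self]
    exact ⟨(hz i hi').1, (hz i hi').2.trans (by omega)⟩

/-- The vertices of `A` other than `u` and not adjacent to `u`. -/
def nonNeighbors (G : SimpleGraph V) (A : Set V) (u : V) : Set V :=
  {t ∈ A | t ≠ u ∧ ¬ G.Adj u t}

theorem adj_of_adj_component {A : Set V} {a u d n : V} (ha : a ∈ nonNeighbors G A u)
    (hd : (edgesInside G (nonNeighbors G A u)).Reachable a d) (hnA : n ∈ A)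
    (hn : ¬ (edgesInside G (nonNeighbors G A u)).Reachable a n) (hnd : G.Adj n d) :
    G.Adj u n := by
  have hdW := mem_of_reachable_edgesInside ha hd
  by_contra hun
  have hnW : n ∈ nonNeighbors G A u := ⟨hnA, fun h => hdW.2.2 (h ▸ hnd), hun⟩
  exact hn (hd.trans (Adj.reachable ⟨hnd.symm, hdW, hnW⟩))

/-- **Dirac's theorem**: a nonempty set of vertices of a chordal graph has a simplicial vertex. -/
theorem exists_simplicial [Finite V] (hG : ∀ m, 4 ≤ m → ¬ HasInduced (cycG m) G) (A : Set V)
    (hA : A.Nonempty) : ∃ v ∈ A, G.IsClique {u ∈ A | G.Adj v u} := by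
  induction hk : A.ncard using Nat.strong_induction_on generalizing A with
  | _ k ih =>
  subst hk
  by_cases hcl : G.IsClique A
  · obtain ⟨v, hv⟩ := hA
    exact ⟨v, hv, hcl.subset fun u hu => hu.1⟩
  obtain ⟨a, haA, b, hbA, hab, hnab⟩ : ∃ a ∈ A, ∃ b ∈ A, a ≠ b ∧ ¬ G.Adj a b := by
    simpa [isClique_iff, Set.Pairwise] using hcl
  obtain ⟨y, hy, hmax⟩ := Set.exists_max_image (nonNeighbors G A a)
    (fun u => {t | (edgesInside G (nonNeighbors G A u)).Reachable a t}.ncard) (Set.toFinite _)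
    ⟨b, hbA, hab.symm, hnab⟩
  have hsymm : ∀ u ∈ nonNeighbors G A a, a ∈ nonNeighbors G A u :=
    fun u hu => ⟨haA, hu.2.1.symm, fun h => hu.2.2 h.symm⟩
  have hay := hsymm y hy
  set D : Set V := {t | (edgesInside G (nonNeighbors G A y)).Reachable a t} with hD
  have haD : a ∈ D := Reachable.refl a
  have hDW : ∀ t ∈ D, t ∈ nonNeighbors G A y := fun t ht => mem_of_reachable_edgesInside hay ht
  have hyR : y ∈ {u ∈ A | u ∉ D ∧ ∀ d ∈ D, ¬ G.Adj u d} :=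
    ⟨hy.1, fun h => (hDW y h).2.1 rfl, fun d hd => (hDW d hd).2.2⟩
  have hlt : {u ∈ A | u ∉ D ∧ ∀ d ∈ D, ¬ G.Adj u d}.ncard < A.ncard :=
    Set.ncard_lt_ncard ⟨fun u hu => hu.1, fun h => (h haA).2.1 haD⟩
  obtain ⟨v, hv, hvcl⟩ := ih _ hlt _ ⟨y, hyR⟩ rfl
  have hcomp : ∀ u ∈ {u ∈ A | u ∉ D ∧ ∀ d ∈ D, ¬ G.Adj u d}, ∀ n ∈ A, n ∉ D →
      ∀ d ∈ D, G.Adj n d → G.Adj u n := by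
    intro u hu n hnA hnD d hd hnd
    have hua : u ∈ nonNeighbors G A a :=
      ⟨hu.1, fun h => hu.2.1 (h ▸ haD), fun h => hu.2.2 a haD h.symm⟩
    have hsub : D ⊆ {t | (edgesInside G (nonNeighbors G A u)).Reachable a t} := by
      intro t ht
      refine (reachable_edgesInside_component ht).mono (edgesInside_mono fun s hs => ?_)
      exact ⟨(hDW s hs).1, fun h => hu.2.1 (h ▸ hs), hu.2.2 s hs⟩
    have heq := Set.eq_of_subset_of_ncard_le hsub (hmax u hua)
    exact adj_of_adj_component (hsymm u hua) (hsub hd) hnA (fun h => hnD (heq.symm.subset h)) hnd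
  have hNcl : ∀ n₁ ∈ A, n₁ ∉ D → ∀ d₁ ∈ D, G.Adj n₁ d₁ → ∀ n₂ ∈ A, n₂ ∉ D → ∀ d₂ ∈ D,
      G.Adj n₂ d₂ → n₁ ≠ n₂ → G.Adj n₁ n₂ := by
    intro n₁ h₁A h₁D d₁ hd₁ h₁ n₂ h₂A h₂D d₂ hd₂ h₂ hne
    by_contra hnadj
    refine not_reachable_edgesInside_of_chordal hG (W := nonNeighbors G A y)
      (fun t ht => ht.2) (hcomp y hyR n₁ h₁A h₁D d₁ hd₁ h₁) (hcomp y hyR n₂ h₂A h₂D d₂ hd₂ h₂)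
      hne hnadj ?_
    have hmid : (edgesInside G (nonNeighbors G A y)).Reachable d₁ d₂ :=
      (show (edgesInside G _).Reachable a d₁ from hd₁).symm.trans hd₂
    have hstart : (edgesInside G (insert n₁ (insert n₂ (nonNeighbors G A y)))).Adj n₁ d₁ :=
      ⟨h₁, by simp, by simp [hDW d₁ hd₁]⟩
    have hend : (edgesInside G (insert n₁ (insert n₂ (nonNeighbors G A y)))).Adj d₂ n₂ :=
      ⟨h₂.symm, by simp [hDW d₂ hd₂], by simp⟩
    refine (hstart.reachable.trans (hmid.mono (edgesInside_mono ?_))).trans hend.reachable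
    exact (Set.subset_insert _ _).trans (Set.subset_insert _ _)
  have hcases : ∀ u ∈ {u ∈ A | G.Adj v u},
      (u ∈ {u ∈ A | u ∉ D ∧ ∀ d ∈ D, ¬ G.Adj u d}) ∨ u ∈ A ∧ u ∉ D ∧ ∃ d ∈ D, G.Adj u d := by
    rintro u ⟨huA, hvu⟩
    have huD : u ∉ D := fun h => hv.2.2 u h hvu
    by_cases hd : ∃ d ∈ D, G.Adj u d
    · exact Or.inr ⟨huA, huD, hd⟩
    · exact Or.inl ⟨huA, huD, fun d hdD h => hd ⟨d, hdD, h⟩⟩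
  refine ⟨v, hv.1, fun u hu w hw huw => ?_⟩
  rcases hcases u hu with h1 | ⟨h1, h2, d, h3, h4⟩ <;>
    rcases hcases w hw with h1' | ⟨h1', h2', d', h3', h4'⟩
  · exact hvcl ⟨h1, hu.2⟩ ⟨h1', hw.2⟩ huw
  · exact hcomp u h1 w h1' h2' d' h3' h4'
  · exact (hcomp w h1' u h1 h2 d h3 h4).symm
  · exact hNcl u h1 h2 d h3 h4 w h1' h2' d' h3' h4' huw

end Simplicial

theorem exists_isCliquePath {V : Type*} [Finite V] {G : SimpleGraph V}
    (hchordal : ∀ m, 4 ≤ m → ¬ HasInduced (cycG m) G) (hG : ¬ HasObstruction G) (A : Set V) :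
    ∃ N P, IsCliquePath G A N P := by
  induction hk : A.ncard generalizing A with
  | zero =>
    obtain rfl : A = ∅ := (Set.ncard_eq_zero (Set.toFinite A)).1 hk
    exact ⟨0, fun _ => ∅, by simp, by simp, by simp, by simp, by simp⟩
  | succ k ih =>
    obtain ⟨v, hv, hcl⟩ := exists_simplicial hchordal A
      (Set.nonempty_of_ncard_ne_zero (by omega))
    obtain ⟨N, P, h⟩ := ih (A \ {v}) (by rw [Set.ncard_sdiff_singleton_of_mem hv]; omega)
    have hsub : {u ∈ A \ {v} | G.Adj v u} ⊆ {u ∈ A | G.Adj v u} := fun u hu => ⟨hu.1.1, hu.2⟩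
    have := h.exists_insert (by simp) (hcl.subset hsub) hG
    rwa [Set.insert_sdiff_singleton, Set.insert_eq_of_mem hv] at this

theorem Icc_inter_Icc_nonempty_iff {a b c d : ℝ} (hab : a ≤ b) (hcd : c ≤ d) :
    (Set.Icc a b ∩ Set.Icc c d).Nonempty ↔ a ≤ d ∧ c ≤ b := by
  rw [Set.Icc_inter_Icc, Set.nonempty_Icc, sup_le_iff, le_inf_iff, le_inf_iff]
  tauto

/-- An interval model inside `[0, 1)` is also a circular-arc model. -/
theorem IsIntervalModel.isCAModel {V : Type*} {G : SimpleGraph V} {M : V → ℝ × ℝ}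
    (h : IsIntervalModel G M) (hM : ∀ v, 0 ≤ (M v).1 ∧ (M v).2 < 1) : IsCAModel G M := by
  refine ⟨h.1, fun u v huv => (h.2 u v huv).trans ?_⟩
  have hmem : ∀ w, ∀ x ∈ Set.Icc (M w).1 (M w).2, x ∈ Set.Ico (0 : ℝ) (0 + 1) := fun w x hx =>
    ⟨(hM w).1.trans hx.1, by rw [zero_add]; exact hx.2.trans_lt (hM w).2⟩
  constructor
  · rintro ⟨x, hxu, hxv⟩
    exact ⟨x, ⟨x, hxu, rfl⟩, ⟨x, hxv, rfl⟩⟩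
  · rintro ⟨_, ⟨x, hx, rfl⟩, ⟨y, hy, hyx⟩⟩
    have : Fact ((0 : ℝ) < 1) := ⟨one_pos⟩
    obtain rfl : y = x := (AddCircle.coe_eq_coe_iff_of_mem_Ico (hmem v y hy) (hmem u x hx)).1 hyx
    exact ⟨y, hx, hy⟩

/-- every chordal graph with no induced bipartite claw, umbrella,
`k`-net (`k ≥ 2`) and `k`-tent (`k ≥ 3`) is an interval graph, and in particular a
circular-arc graph. -/
theorem stmt10 {V : Type*} [Finite V] (G : SimpleGraph V)
    (hchordal : ∀ m, 4 ≤ m → ¬ HasInduced (cycG m) G)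
    (hbc : ¬ HasInduced bipartiteClaw G) (humb : ¬ HasInduced umbrella G)
    (hnet : ∀ k, 2 ≤ k → ¬ HasInduced (kNet k) G)
    (htent : ∀ k, 3 ≤ k → ¬ HasInduced (kTent k) G) :
    IsIntervalGraph G ∧ IsCircularArcGraph G := by
  have hG : ¬ HasObstruction G := by
    rintro (h | h | ⟨k, hk, h⟩ | ⟨k, hk, h⟩)
    exacts [hbc h, humb h, hnet k hk h, htent k hk h]
  obtain ⟨N, P, h⟩ := exists_isCliquePath hchordal hG Set.univ
  obtain ⟨l, r, hlr⟩ := h.exists_ends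
  have hN : (0 : ℝ) < N + 1 := by positivity
  have hM : IsIntervalModel G fun v => ((l v : ℝ) / (N + 1), (r v : ℝ) / (N + 1)) := by
    have hle : ∀ v, (l v : ℝ) / (N + 1) ≤ r v / (N + 1) := fun v => by
      rw [div_le_div_iff_of_pos_right hN]
      exact_mod_cast (hlr v trivial).1
    refine ⟨hle, fun u v huv => ?_⟩
    rw [Icc_inter_Icc_nonempty_iff (hle u) (hle v), div_le_div_iff_of_pos_right hN,
      div_le_div_iff_of_pos_right hN, Nat.cast_le, Nat.cast_le]
    exact h.adj_iff hlr trivial trivial huv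
  refine ⟨⟨_, hM⟩, _, hM.isCAModel fun v => ⟨by positivity, ?_⟩⟩
  rw [div_lt_one hN]
  exact_mod_cast Nat.lt_succ_of_le (hlr v trivial).2.1
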